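/- arXiv:2303.06104 — 2 statements merged into one kernel-verified Lean document; each statement's English description precedes it below -/
import Mathlib

section
/- Let Φ ∈ ℝ \ ℤ and α > 0, and let V : ℝ² → ℝ be measurable with ∫_{ℝ²} V(x)_+^{1+α/2} |x|^α dx < ∞. Then every finite-dimensional complex subspace M of C_c^∞(ℝ²\{0}; ℂ) that is V-negative for D_Φ satisfies dim M ≤ (Γ((1+α)/2) / (4 π^{3/2} Γ(1+α/2))) · (∑_{n∈ℤ} |n−Φ|^{−1−α}) · ∫_{ℝ²} V(x)_+^{1+α/2} |x|^α dx. (Weighted Cwikel–Lieb–Rozenblum bound for the Aharonov–Bohm operator, with explicit constant.) -/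
open MeasureTheory

/-- The square of the Euclidean norm on `ℝ²`. -/
noncomputable def sqnorm (x : ℝ × ℝ) : ℝ := x.1 ^ 2 + x.2 ^ 2

/-- Smooth compactly supported functions on `ℝ²` vanishing in a neighbourhood of `0`. -/
def IsTestFun (u : ℝ × ℝ → ℂ) : Prop :=
  ContDiff ℝ (⊤ : ℕ∞) u ∧ HasCompactSupport u ∧ ∀ᶠ x in nhds (0 : ℝ × ℝ), u x = 0

/-- The magnetic energy `∫ |D_Φ u|²` for the Aharonov–Bohm vector potential
`A(x) = |x|⁻² (x₂, -x₁)`, where `D_Φ u = -i∇u + Φ A u`. -/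
noncomputable def magEnergy (Φ : ℝ) (u : ℝ × ℝ → ℂ) : ℝ :=
  ∫ x : ℝ × ℝ,
    (‖-Complex.I * fderiv ℝ u x (1, 0) + ((Φ * (x.2 / sqnorm x) : ℝ) : ℂ) * u x‖ ^ 2 +
     ‖-Complex.I * fderiv ℝ u x (0, 1) + ((Φ * (-x.1 / sqnorm x) : ℝ) : ℂ) * u x‖ ^ 2)

/-- A finite-dimensional subspace `M` of test functions is `V`-negative for `D_Φ` if
every nonzero `u ∈ M` satisfies `∫ |D_Φ u|² < ∫ V |u|²`. -/
def IsVNegative (Φ : ℝ) (V : ℝ × ℝ → ℝ) (M : Submodule ℂ (ℝ × ℝ → ℂ)) : Prop :=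
  (∀ u ∈ M, IsTestFun u) ∧
  ∀ u ∈ M, u ≠ 0 → magEnergy Φ u < ∫ x : ℝ × ℝ, V x * ‖u x‖ ^ 2

open scoped ComplexOrder in
theorem Matrix.norm_det_sq_le_of_sum_norm_sq_le {N : ℕ} (A : Matrix (Fin N) (Fin N) ℂ) {s : ℝ}
    (h : ∑ i, ∑ j, ‖A i j‖ ^ 2 ≤ N * s) : ‖A.det‖ ^ 2 ≤ s ^ N := by
  rcases Nat.eq_zero_or_pos N with rfl | hN
  · simp
  have hN' : (0 : ℝ) < N := by exact_mod_cast hN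
  have hP := Matrix.posSemidef_conjTranspose_mul_self A
  have hH := hP.isHermitian
  have hdet : ((‖A.det‖ ^ 2 : ℝ) : ℂ) = ((∏ i, hH.eigenvalues i : ℝ) : ℂ) := by
    have h1 := hH.det_eq_prod_eigenvalues
    rw [Matrix.det_mul, Matrix.det_conjTranspose] at h1
    push_cast
    rw [← Complex.conj_mul']
    simpa using h1
  have htr : ((∑ i, ∑ j, ‖A i j‖ ^ 2 : ℝ) : ℂ) = ((∑ i, hH.eigenvalues i : ℝ) : ℂ) := by
    have h1 := hH.trace_eq_sum_eigenvalues
    simp only [Matrix.trace, Matrix.diag, Matrix.mul_apply, Matrix.conjTranspose_apply] at h1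
    rw [Finset.sum_comm]
    push_cast
    simp only [← Complex.conj_mul']
    simpa using h1
  have hdet' := Complex.ofReal_injective hdet
  have htr' := Complex.ofReal_injective htr
  have hnn : ∀ i, 0 ≤ hH.eigenvalues i := hP.eigenvalues_nonneg
  have := Real.geom_mean_le_arith_mean Finset.univ (fun _ => (1 : ℝ)) hH.eigenvalues
    (by simp) (by simpa using hN) (by simpa using hnn)
  simp only [Real.rpow_one, Finset.sum_const, Finset.card_univ, Fintype.card_fin, nsmul_eq_mul,
    mul_one, one_mul] at this
  rw [← htr', ← hdet'] at this
  have h2 : (‖A.det‖ ^ 2) ^ ((N : ℝ)⁻¹) ≤ s := this.trans (by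
    rw [div_le_iff₀ hN']; linarith)
  calc ‖A.det‖ ^ 2 = ((‖A.det‖ ^ 2) ^ ((N : ℝ)⁻¹)) ^ N := by
        rw [Real.rpow_inv_natCast_pow (by positivity) hN.ne']
    _ ≤ s ^ N := by gcongr

theorem exists_orthonormal_orthogonal {M E F : Type*} [AddCommGroup M] [Module ℂ M]
    [FiniteDimensional ℂ M] [NormedAddCommGroup E] [InnerProductSpace ℂ E]
    [NormedAddCommGroup F] [InnerProductSpace ℂ F] (a : M →ₗ[ℂ] E) (ha : Function.Injective a)
    (b : M →ₗ[ℂ] F) :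
    ∃ u : Fin (Module.finrank ℂ M) → M, Orthonormal ℂ (fun i => a (u i)) ∧
      Pairwise fun i j => inner ℂ (b (u i)) (b (u j)) = 0 := by
  let e : M ≃ₗ[ℂ] LinearMap.range a := LinearEquiv.ofInjective a ha
  let J : LinearMap.range a →ₗ[ℂ] LinearMap.range b := b.rangeRestrict ∘ₗ e.symm.toLinearMap
  have hS : (J.adjoint ∘ₗ J).IsSymmetric := by
    intro x y
    simp [LinearMap.adjoint_inner_left, LinearMap.adjoint_inner_right]
  have hn : Module.finrank ℂ (LinearMap.range a) = Module.finrank ℂ M := e.finrank_eq.symm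
  let v := hS.eigenvectorBasis hn
  refine ⟨fun i => e.symm (v i), ?_, ?_⟩
  · have h1 : (fun i => a (e.symm (v i))) = fun i => ((v i : LinearMap.range a) : E) := by
      funext i
      exact congrArg Subtype.val (e.apply_symm_apply (v i))
    rw [h1]
    exact v.orthonormal.comp_linearIsometry (LinearMap.range a).subtypeₗᵢ
  · intro i j hij
    have h1 : inner ℂ (b (e.symm (v i))) (b (e.symm (v j))) = inner ℂ (J (v i)) (J (v j)) := rfl
    rw [h1, ← LinearMap.adjoint_inner_right]
    have h2 := hS.apply_eigenvectorBasis hn j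
    simp only [LinearMap.comp_apply] at h2
    change inner ℂ (v i) (J.adjoint (J (v j))) = 0
    rw [h2, inner_smul_right, v.orthonormal.2 hij, mul_zero]

theorem sum_norm_integral_conj_mul_sq_le {X : Type*} [MeasurableSpace X] {μ : Measure X} {N : ℕ}
    {g : Fin N → X → ℂ} (hg : ∀ i, MemLp (g i) 2 μ)
    (hon : ∀ i j, ∫ x, starRingEnd ℂ (g i x) * g j x ∂μ = if i = j then 1 else 0)
    {v : X → ℂ} (hv : MemLp v 2 μ) :
    ∑ i, ‖∫ x, starRingEnd ℂ (g i x) * v x ∂μ‖ ^ 2 ≤ ∫ x, ‖v x‖ ^ 2 ∂μ := by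
  have hinner : ∀ {a b : X → ℂ} (ha : MemLp a 2 μ) (hb : MemLp b 2 μ),
      inner ℂ (ha.toLp a) (hb.toLp b) = ∫ x, starRingEnd ℂ (a x) * b x ∂μ := by
    intro a b ha hb
    rw [L2.inner_def]
    refine integral_congr_ae ?_
    filter_upwards [ha.coeFn_toLp, hb.coeFn_toLp] with x h1 h2
    simp [h1, h2, mul_comm]
  have hO : Orthonormal ℂ (fun i => (hg i).toLp (g i)) := by
    rw [orthonormal_iff_ite]
    intro i j
    rw [hinner, hon]
  have h1 := hO.sum_inner_products_le (x := hv.toLp v) (s := Finset.univ)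
  simp only [hinner] at h1
  refine h1.trans (le_of_eq ?_)
  have h2 : ((‖hv.toLp v‖ ^ 2 : ℝ) : ℂ) = ((∫ x, ‖v x‖ ^ 2 ∂μ : ℝ) : ℂ) := by
    have h3 := inner_self_eq_norm_sq_to_K (𝕜 := ℂ) (hv.toLp v)
    rw [hinner] at h3
    push_cast
    rw [← integral_complex_ofReal]
    simp only [Complex.conj_mul'] at h3
    simpa using h3.symm
  exact Complex.ofReal_injective h2

open Complex.HadamardThreeLines in
theorem norm_cexp_mul_ofReal_le {z : ℂ} (hz : z ∈ verticalClosedStrip 0 1) (s : ℝ) :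
    ‖Complex.exp (z * s)‖ ≤ 1 + Real.exp s := by
  obtain ⟨h0, h1⟩ := hz
  rw [Complex.norm_exp, Complex.re_mul_ofReal]
  rcases le_total 0 s with hs | hs
  · have : z.re * s ≤ s := by nlinarith
    have := Real.exp_le_exp.2 this
    linarith
  · have : z.re * s ≤ 0 := by nlinarith
    have := Real.exp_le_one_iff.2 this
    have := Real.exp_pos s
    linarith

section StripIntegral

open Complex.HadamardThreeLines

variable {Y : Type*} [MeasurableSpace Y] {μ : Measure Y} {c : Y → ℂ} {s : Y → ℝ}

theorem integrable_norm_mul_one_add_exp (hc : Integrable c μ)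
    (hcs : Integrable (fun y => c y * Real.exp (s y)) μ) :
    Integrable (fun y => ‖c y‖ * (1 + Real.exp (s y))) μ := by
  refine (hc.norm.add hcs.norm).congr (.of_forall fun y => ?_)
  simp [mul_add]

theorem integrable_mul_cexp (hc : Integrable c μ) (hs : Measurable s)
    (hcs : Integrable (fun y => c y * Real.exp (s y)) μ) {z : ℂ}
    (hz : z ∈ verticalClosedStrip 0 1) :
    Integrable (fun y => c y * Complex.exp (z * s y)) μ := by
  refine (integrable_norm_mul_one_add_exp hc hcs).mono' ?_ (.of_forall fun y => ?_)
  · exact hc.aestronglyMeasurable.mul (by fun_prop)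
  · rw [norm_mul]
    gcongr
    exact norm_cexp_mul_ofReal_le hz _

theorem diffContOnCl_integral_mul_cexp (hc : Integrable c μ) (hs : Measurable s)
    (hcs : Integrable (fun y => c y * Real.exp (s y)) μ) :
    DiffContOnCl ℂ (fun z : ℂ => ∫ y, c y * Complex.exp (z * s y) ∂μ) (verticalStrip 0 1) := by
  have hclos : closure (verticalStrip 0 1) ⊆ verticalClosedStrip 0 1 :=
    closure_minimal (Set.preimage_mono Set.Ioo_subset_Icc_self)
      (isClosed_Icc.preimage Complex.continuous_re)
  constructor
  · intro z hz
    obtain ⟨h0, h1⟩ := hz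
    set ε := min z.re (1 - z.re) / 2 with hε
    have hε0 : 0 < ε := by
      have : 0 < min z.re (1 - z.re) := lt_min h0 (by linarith)
      positivity
    have hε1 : 2 * ε ≤ z.re := by rw [hε]; linarith [min_le_left z.re (1 - z.re)]
    have hε2 : 2 * ε ≤ 1 - z.re := by rw [hε]; linarith [min_le_right z.re (1 - z.re)]
    refine (hasDerivAt_integral_of_dominated_loc_of_deriv_le
      (F' := fun w y => c y * (Complex.exp (w * s y) * s y))
      (bound := fun y => ‖c y‖ * (1 + Real.exp (s y)) * ε⁻¹)
      (Metric.ball_mem_nhds z hε0) ?_ ?_ ?_ ?_ ?_ ?_).2.differentiableAt.differentiableWithinAt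
    · exact .of_forall fun w => hc.aestronglyMeasurable.mul (by fun_prop)
    · exact integrable_mul_cexp hc hs hcs ⟨h0.le, h1.le⟩
    · exact hc.aestronglyMeasurable.mul (by fun_prop)
    · refine .of_forall fun y w hw => ?_
      have hw' : |w.re - z.re| < ε := by
        rw [Metric.mem_ball, dist_eq_norm] at hw
        simpa using (Complex.abs_re_le_norm (w - z)).trans_lt hw
      rw [abs_lt] at hw'
      rw [norm_mul, mul_assoc]
      gcongr
      rw [norm_mul, Complex.norm_exp, Complex.re_mul_ofReal, Complex.norm_real, Real.norm_eq_abs,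
        ← div_eq_mul_inv, le_div_iff₀ hε0]
      have hexp : |s y| * ε ≤ Real.exp (ε * |s y|) := by
        have := Real.add_one_le_exp (ε * |s y|); linarith
      have h2 : Real.exp (w.re * s y) * |s y| * ε ≤ Real.exp (w.re * s y + ε * |s y|) := by
        rw [Real.exp_add, mul_assoc]; gcongr
      refine h2.trans ?_
      rcases le_total 0 (s y) with hsy | hsy
      · rw [abs_of_nonneg hsy]
        have : w.re * s y + ε * s y ≤ s y := by nlinarith
        linarith [Real.exp_le_exp.2 this]
      · rw [abs_of_nonpos hsy]
        have : w.re * s y + ε * -s y ≤ 0 := by nlinarith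
        linarith [Real.exp_le_one_iff.2 this, Real.exp_pos (s y)]
    · exact (integrable_norm_mul_one_add_exp hc hcs).mul_const _
    · refine .of_forall fun y w _ => ?_
      have := ((hasDerivAt_id w).mul_const (s y : ℂ)).cexp.const_mul (c y)
      simpa using this
  · refine ContinuousOn.mono ?_ hclos
    refine continuousOn_of_dominated (bound := fun y => ‖c y‖ * (1 + Real.exp (s y))) ?_ ?_
      (integrable_norm_mul_one_add_exp hc hcs) ?_
    · exact fun w _ => hc.aestronglyMeasurable.mul (by fun_prop)
    · refine fun w hw => .of_forall fun y => ?_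
      rw [norm_mul]
      gcongr
      exact norm_cexp_mul_ofReal_le hw _
    · exact .of_forall fun y => by fun_prop

end StripIntegral

open Complex.HadamardThreeLines in
theorem card_le_integral_rpow_mul_integral_rpow {X K : Type*} [MeasurableSpace X]
    [MeasurableSpace K] {μ : Measure X} {ν : Measure K} [SFinite μ] [SFinite ν] {N : ℕ}
    {p : ℝ} (hp : 1 < p) {e : X → K → ℂ} (he : Measurable (Function.uncurry e))
    (he1 : ∀ x k, ‖e x k‖ ≤ 1)
    (hS : ∀ h : K → ℂ, Integrable h ν → MemLp h 2 ν →
      MemLp (fun x => ∫ k, h k * e x k ∂ν) 2 μ ∧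
        ∫ x, ‖∫ k, h k * e x k ∂ν‖ ^ 2 ∂μ ≤ ∫ k, ‖h k‖ ^ 2 ∂ν)
    {m : K → ℝ} (hm : Measurable m) {δ : ℝ} (hδ : 0 < δ) (hmδ : ∀ k, δ ≤ m k)
    (hmp : Integrable (fun k => m k ^ (-p)) ν)
    {W : X → ℝ} (hW : Measurable W) (hW0 : ∀ x, 0 ≤ W x) (hWp : Integrable (fun x => W x ^ p) μ)
    {u : Fin N → X → ℂ} {C : ℝ} (huC : ∀ i x, ‖u i x‖ ≤ C) (hui : ∀ i, Integrable (u i) μ)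
    {f : Fin N → K → ℂ} (hf1 : ∀ i, Integrable (f i) ν) (hf2 : ∀ i, MemLp (f i) 2 ν)
    (hfon : ∀ i j, ∫ k, starRingEnd ℂ (f i k) * f j k ∂ν = if i = j then 1 else 0)
    (hrep : ∀ i, ∀ᵐ x ∂μ, u i x = ∫ k, ((√(m k))⁻¹ : ℝ) * f i k * e x k ∂ν)
    (horth : ∀ i j, i ≠ j → ∫ x, W x * (starRingEnd ℂ (u i x) * u j x) ∂μ = 0)
    (hlam : ∀ i, 1 ≤ ∫ x, W x * ‖u i x‖ ^ 2 ∂μ) :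
    (N : ℝ) ≤ (∫ x, W x ^ p ∂μ) * ∫ k, m k ^ (-p) ∂ν := by
  have hp0 : 0 < p := by linarith
  have hm0 : ∀ k, 0 < m k := fun k => hδ.trans_le (hmδ k)
  rcases Nat.eq_zero_or_pos N with rfl | hN
  · have h1 : 0 ≤ ∫ x, W x ^ p ∂μ := integral_nonneg fun x => Real.rpow_nonneg (hW0 x) _
    have h2 : 0 ≤ ∫ k, m k ^ (-p) ∂ν := integral_nonneg fun k => Real.rpow_nonneg (hm0 k).le _
    simpa using mul_nonneg h1 h2
  have hN' : (0 : ℝ) < N := by exact_mod_cast hN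
  set lam : Fin N → ℝ := fun i => ∫ x, W x * ‖u i x‖ ^ 2 ∂μ with hlamdef
  have hlam0 : ∀ i, 0 < lam i := fun i => one_pos.trans_le (hlam i)
  -- powers of `W` against `u`
  have hWu : ∀ (q : ℝ) (i : Fin N), 0 ≤ q → q ≤ p →
      Integrable (fun x => ((W x ^ q : ℝ) : ℂ) * u i x) μ := by
    intro q i hq0 hqp
    refine Integrable.mono' ((hui i).norm.add (hWp.mul_const C)) ?_ (.of_forall fun x => ?_)
    · exact AEStronglyMeasurable.mul (by fun_prop) (hui i).aestronglyMeasurable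
    · have hn : 0 ≤ W x ^ q := Real.rpow_nonneg (hW0 x) _
      rw [norm_mul, Complex.norm_real, Real.norm_of_nonneg hn]
      have h2 := huC i x
      have h3 := norm_nonneg (u i x)
      have h5 : 0 ≤ W x ^ p := Real.rpow_nonneg (hW0 x) _
      simp only [Pi.add_apply]
      rcases le_total (W x) 1 with h | h
      · have := Real.rpow_le_one (hW0 x) h hq0
        have h4 : 0 ≤ C := h3.trans h2
        nlinarith [mul_nonneg h5 h4]
      · have := Real.rpow_le_rpow_of_exponent_le h hqp
        nlinarith
  have hWuu : ∀ i j, Integrable (fun x => (W x : ℂ) * (starRingEnd ℂ (u i x) * u j x)) μ := by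
    intro i j
    have h1 := hWu 1 j zero_le_one hp.le
    have h2 : Integrable (fun x => starRingEnd ℂ (u i x) * (((W x ^ (1 : ℝ) : ℝ) : ℂ) * u j x)) μ :=
      h1.bdd_mul (Complex.continuous_conj.comp_aestronglyMeasurable (hui i).aestronglyMeasurable)
        (.of_forall fun x => by simpa using huC i x)
    refine h2.congr (.of_forall fun x => ?_)
    simp only [Real.rpow_one]; ring
  -- the orthonormal family
  set g : Fin N → X → ℂ := fun j x => (((√(lam j))⁻¹ * √(W x) : ℝ) : ℂ) * u j x with hg
  have hgm : ∀ j, AEStronglyMeasurable (g j) μ := fun j =>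
    AEStronglyMeasurable.mul (by fun_prop) (hui j).aestronglyMeasurable
  have hgq : ∀ (q : ℝ) (j : Fin N), 0 ≤ q → 1 / 2 + q ≤ p →
      Integrable (fun x => g j x * ((W x ^ q : ℝ) : ℂ)) μ := by
    intro q j hq hqp
    refine ((hWu (1 / 2 + q) j (by positivity) hqp).const_mul ((√(lam j))⁻¹ : ℂ)).congr
      (.of_forall fun x => ?_)
    simp only [hg]
    rw [Real.rpow_add_of_nonneg (hW0 x) (by positivity) hq, ← Real.sqrt_eq_rpow]
    push_cast; ring
  have hg2 : ∀ j, MemLp (g j) 2 μ := by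
    intro j
    rw [memLp_two_iff_integrable_sq_norm (hgm j)]
    refine ((hWuu j j).norm.const_mul (lam j)⁻¹).congr (.of_forall fun x => ?_)
    simp only [hg, norm_mul, Complex.norm_real, RCLike.norm_conj, norm_inv, Complex.ofReal_mul,
      mul_pow, Real.norm_eq_abs, sq_abs, Complex.ofReal_inv, inv_pow, Real.sq_sqrt (hlam0 j).le,
      Real.sq_sqrt (hW0 x), abs_of_nonneg (hW0 x)]
    ring
  have hlamC : ∀ i, ∫ x, W x * (starRingEnd ℂ (u i x) * u i x) ∂μ = (lam i : ℂ) := by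
    intro i
    simp only [hlamdef, Complex.conj_mul']
    rw [← integral_complex_ofReal]
    simp
  have hgu : ∀ i j, ∫ x, starRingEnd ℂ (g i x) * (((√(W x) : ℝ) : ℂ) * u j x) ∂μ
      = if i = j then ((√(lam i) : ℝ) : ℂ) else 0 := by
    intro i j
    have h1 : ∀ x, starRingEnd ℂ (g i x) * (((√(W x) : ℝ) : ℂ) * u j x)
        = (((√(lam i))⁻¹ : ℝ) : ℂ) * (W x * (starRingEnd ℂ (u i x) * u j x)) := by
      intro x
      have h2 : ((√(W x) : ℝ) : ℂ) * ((√(W x) : ℝ) : ℂ) = (W x : ℂ) := by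
        rw [← Complex.ofReal_mul, Real.mul_self_sqrt (hW0 x)]
      simp only [hg, map_mul, Complex.conj_ofReal, ← h2]
      push_cast; ring
    simp only [h1]
    rw [integral_const_mul]
    split_ifs with h
    · subst h
      rw [hlamC, ← Complex.ofReal_mul]
      congr 1
      have := Real.mul_self_sqrt (hlam0 i).le
      have h3 : 0 < √(lam i) := Real.sqrt_pos.2 (hlam0 i)
      field_simp
      linarith
    · rw [horth i j h, mul_zero]
  have hgon : ∀ i j, ∫ x, starRingEnd ℂ (g i x) * g j x ∂μ = if i = j then 1 else 0 := by
    intro i j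
    have h1 : ∀ x, starRingEnd ℂ (g i x) * g j x
        = (((√(lam j))⁻¹ : ℝ) : ℂ) * (starRingEnd ℂ (g i x) * (((√(W x) : ℝ) : ℂ) * u j x)) := by
      intro x
      simp only [hg]
      push_cast; ring
    simp only [h1]
    rw [integral_const_mul, hgu]
    split_ifs with h
    · subst h
      have h3 : 0 < √(lam i) := Real.sqrt_pos.2 (hlam0 i)
      rw [← Complex.ofReal_mul, inv_mul_cancel₀ h3.ne', Complex.ofReal_one]
    · simp
  -- the analytic family
  set s : X × K → ℝ := fun y => p / 2 * (Real.log (W y.1) - Real.log (m y.2)) with hs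
  have hsm : Measurable s := by
    refine Measurable.const_mul (Measurable.sub ?_ ?_) _
    · exact Real.measurable_log.comp (hW.comp measurable_fst)
    · exact Real.measurable_log.comp (hm.comp measurable_snd)
  set c : Fin N → Fin N → X × K → ℂ := fun j i y =>
    starRingEnd ℂ (g j y.1) * f i y.2 * e y.1 y.2 with hc
  have hgconj : ∀ (q : ℝ) (j : Fin N), 0 ≤ q → 1 / 2 + q ≤ p →
      Integrable (fun x => starRingEnd ℂ (g j x) * ((W x ^ q : ℝ) : ℂ)) μ := by
    intro q j hq hqp
    have := (Complex.conjCLE : ℂ →L[ℝ] ℂ).integrable_comp (hgq q j hq hqp)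
    refine this.congr (.of_forall fun x => ?_)
    simp
  have hcI : ∀ j i, Integrable (c j i) (μ.prod ν) := by
    intro j i
    have h1 := (hgconj 0 j le_rfl (by linarith)).mul_prod (hf1 i)
    have h2 := h1.mul_bdd (c := 1) (g := Function.uncurry e) he.aestronglyMeasurable
      (.of_forall fun y => he1 _ _)
    refine h2.congr (.of_forall fun y => ?_)
    simp [hc, Function.uncurry]
  have hmhalf : ∀ k, ‖((m k ^ (-(p / 2)) : ℝ) : ℂ)‖ ≤ δ ^ (-(p / 2)) := by
    intro k
    rw [Complex.norm_real, Real.norm_of_nonneg (Real.rpow_nonneg (hm0 k).le _)]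
    exact Real.rpow_le_rpow_of_nonpos hδ (hmδ k) (by linarith)
  have hcsI : ∀ j i, Integrable (fun y => c j i y * Real.exp (s y)) (μ.prod ν) := by
    intro j i
    have hf' : Integrable (fun k => f i k * ((m k ^ (-(p / 2)) : ℝ) : ℂ)) ν :=
      (hf1 i).mul_bdd (Measurable.aestronglyMeasurable (by fun_prop)) (.of_forall hmhalf)
    have h1 := (hgconj (p / 2) j (by linarith) (by linarith)).mul_prod hf'
    have h2 := h1.mul_bdd (c := 1) (g := Function.uncurry e) he.aestronglyMeasurable
      (.of_forall fun y => he1 _ _)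
    refine h2.congr (.of_forall fun y => ?_)
    simp only [hc, hs, Function.uncurry]
    rcases (hW0 y.1).eq_or_lt with h | h
    · simp [hg, ← h]
    · rw [Real.rpow_def_of_pos h, Real.rpow_def_of_pos (hm0 y.2), mul_sub, sub_eq_add_neg,
        Real.exp_add]
      push_cast
      ring_nf
  set F : ℂ → Matrix (Fin N) (Fin N) ℂ := fun z => Matrix.of fun j i =>
    ∫ y, c j i y * Complex.exp (z * s y) ∂(μ.prod ν) with hF
  set wz : ℂ → X → ℂ := fun z x =>
    if W x = 0 then 0 else Complex.exp (z * (p / 2 * Real.log (W x) : ℝ)) with hwz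
  set L : ℂ → Fin N → K → ℂ := fun z i k =>
    Complex.exp (z * (-(p / 2 * Real.log (m k)) : ℝ)) * f i k with hL
  have hwm : ∀ z, Measurable (wz z) := fun z =>
    Measurable.ite (hW (measurableSet_singleton 0)) measurable_const (by fun_prop)
  have hFiter : ∀ z ∈ verticalClosedStrip 0 1, ∀ j i, F z j i =
      ∫ x, starRingEnd ℂ (g j x) * (wz z x * ∫ k, L z i k * e x k ∂ν) ∂μ := by
    intro z hz j i
    simp only [hF, Matrix.of_apply]
    rw [integral_prod _ (integrable_mul_cexp (hcI j i) hsm (hcsI j i) hz)]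
    refine integral_congr_ae (.of_forall fun x => ?_)
    simp only
    rw [← integral_const_mul, ← integral_const_mul]
    refine integral_congr_ae (.of_forall fun k => ?_)
    simp only [hc, hs, hwz, hL]
    split_ifs with h
    · simp [hg, h]
    · have h4 : z * ((p / 2 * (Real.log (W x) - Real.log (m k)) : ℝ) : ℂ)
          = z * ((p / 2 * Real.log (W x) : ℝ) : ℂ) + z * ((-(p / 2 * Real.log (m k)) : ℝ) : ℂ) := by
        push_cast; ring
      rw [h4, Complex.exp_add]
      ring
  have hcol : ∀ z ∈ verticalClosedStrip 0 1, ∀ i,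
      MemLp (fun x => wz z x * ∫ k, L z i k * e x k ∂ν) 2 μ →
      ∑ j, ‖F z j i‖ ^ 2 ≤ ∫ x, ‖wz z x * ∫ k, L z i k * e x k ∂ν‖ ^ 2 ∂μ := by
    intro z hz i hv
    simp only [hFiter z hz]
    exact sum_norm_integral_conj_mul_sq_le hg2 hgon hv
  have hLn : ∀ z i k, ‖L z i k‖ = Real.exp (z.re * -(p / 2 * Real.log (m k))) * ‖f i k‖ := by
    intro z i k
    simp only [hL, norm_mul, Complex.norm_exp, Complex.re_mul_ofReal]
  have hSm : ∀ (h : K → ℂ), AEStronglyMeasurable h ν →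
      AEStronglyMeasurable (fun x => ∫ k, h k * e x k ∂ν) μ := by
    intro h hh
    have h1 : AEStronglyMeasurable (fun y : X × K => h y.2 * e y.1 y.2) (μ.prod ν) :=
      hh.comp_snd.mul he.aestronglyMeasurable
    exact h1.integral_prod_right'
  have hLm : ∀ z i, AEStronglyMeasurable (L z i) ν := fun z i =>
    AEStronglyMeasurable.mul (Measurable.aestronglyMeasurable (by fun_prop))
      (hf1 i).aestronglyMeasurable
  have hdet0 : ∀ z ∈ Complex.re ⁻¹' {(0 : ℝ)}, ‖(F z).det‖ ≤ 1 := by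
    intro z hz
    have hz : z.re = 0 := hz
    have hzs : z ∈ verticalClosedStrip 0 1 := by simp [verticalClosedStrip, hz]
    have hLn0 : ∀ i k, ‖L z i k‖ = ‖f i k‖ := fun i k => by simp [hLn, hz]
    have hL1 : ∀ i, Integrable (L z i) ν := fun i =>
      (hf1 i).mono (hLm z i) (.of_forall fun k => (hLn0 i k).le)
    have hL2 : ∀ i, MemLp (L z i) 2 ν := fun i =>
      (hf2 i).mono (hLm z i) (.of_forall fun k => (hLn0 i k).le)
    have hw1 : ∀ x, ‖wz z x‖ ≤ 1 := by
      intro x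
      simp only [hwz]
      split_ifs
      · simp
      · simp [Complex.norm_exp, hz]
    have hle : ∀ i x, ‖wz z x * ∫ k, L z i k * e x k ∂ν‖ ≤ ‖∫ k, L z i k * e x k ∂ν‖ := by
      intro i x
      rw [norm_mul]
      exact mul_le_of_le_one_left (norm_nonneg _) (hw1 x)
    have hv : ∀ i, MemLp (fun x => wz z x * ∫ k, L z i k * e x k ∂ν) 2 μ := fun i =>
      (hS _ (hL1 i) (hL2 i)).1.mono
        ((hwm z).aestronglyMeasurable.mul (hSm _ (hLm z i))) (.of_forall (hle i))
    have hsum : ∑ i, ∑ j, ‖F z i j‖ ^ 2 ≤ N * (1 : ℝ) := by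
      rw [Finset.sum_comm]
      calc ∑ i, ∑ j, ‖F z j i‖ ^ 2 ≤ ∑ i : Fin N, (1 : ℝ) := by
            refine Finset.sum_le_sum fun i _ => (hcol z hzs i (hv i)).trans ?_
            calc _ ≤ ∫ x, ‖∫ k, L z i k * e x k ∂ν‖ ^ 2 ∂μ := by
                  refine integral_mono (hv i).norm.integrable_sq
                    (hS _ (hL1 i) (hL2 i)).1.norm.integrable_sq fun x => ?_
                  have := hle i x
                  simp only
                  gcongr
              _ ≤ ∫ k, ‖L z i k‖ ^ 2 ∂ν := (hS _ (hL1 i) (hL2 i)).2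
              _ = 1 := by
                  simp only [hLn0]
                  have h1 := hfon i i
                  simp only [Complex.conj_mul', if_true] at h1
                  have h2 : ((∫ k, ‖f i k‖ ^ 2 ∂ν : ℝ) : ℂ) = 1 := by
                    rw [← integral_complex_ofReal, ← h1]; simp
                  exact_mod_cast h2
        _ = N * 1 := by simp
    have := Matrix.norm_det_sq_le_of_sum_norm_sq_le _ hsum
    rw [one_pow] at this
    exact (sq_le_one_iff₀ (norm_nonneg _)).1 this
  set Q : ℝ := ∫ k, m k ^ (-p) ∂ν with hQ
  set T : ℝ := (∫ x, W x ^ p ∂μ) * Q / N with hT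
  have hdet1 : ∀ z ∈ Complex.re ⁻¹' {(1 : ℝ)}, ‖(F z).det‖ ≤ √(T ^ N) := by
    intro z hz
    have hz : z.re = 1 := hz
    have hzs : z ∈ verticalClosedStrip 0 1 := by simp [verticalClosedStrip, hz]
    have hexpm : ∀ k, Real.exp (-(p / 2 * Real.log (m k))) = m k ^ (-(p / 2)) := by
      intro k
      rw [Real.rpow_def_of_pos (hm0 k)]
      ring_nf
    have hw1 : ∀ x, ‖wz z x‖ ^ 2 = W x ^ p := by
      intro x
      simp only [hwz]
      split_ifs with h
      · simp [h, Real.zero_rpow hp0.ne']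
      · have hWx : 0 < W x := lt_of_le_of_ne (hW0 x) (Ne.symm h)
        rw [Complex.norm_exp, Complex.re_mul_ofReal, hz, one_mul, ← Real.exp_nat_mul,
          Real.rpow_def_of_pos hWx]
        congr 1; push_cast; ring
    set v : X → K → ℂ := fun x k => ((m k ^ (-(p / 2)) : ℝ) : ℂ) * starRingEnd ℂ (e x k) with hv
    have hex : ∀ x, Measurable (e x) := fun x => he.comp measurable_prodMk_left
    have hvsq : ∀ x k, ‖v x k‖ ^ 2 ≤ m k ^ (-p) := by
      intro x k
      have h1 : ‖v x k‖ ≤ m k ^ (-(p / 2)) := by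
        simp only [hv, norm_mul, Complex.norm_real, RCLike.norm_conj,
          Real.norm_of_nonneg (Real.rpow_nonneg (hm0 k).le _)]
        exact mul_le_of_le_one_right (Real.rpow_nonneg (hm0 k).le _) (he1 x k)
      calc ‖v x k‖ ^ 2 ≤ (m k ^ (-(p / 2))) ^ 2 := by gcongr
        _ = m k ^ (-p) := by
          rw [← Real.rpow_natCast, ← Real.rpow_mul (hm0 k).le]; congr 1; push_cast; ring
    have hvm : ∀ x, AEStronglyMeasurable (v x) ν := by
      intro x
      have := hex x
      exact AEStronglyMeasurable.mul (Measurable.aestronglyMeasurable (by fun_prop))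
        (Complex.continuous_conj.measurable.comp this).aestronglyMeasurable
    have hvint : ∀ x, Integrable (fun k => ‖v x k‖ ^ 2) ν := fun x =>
      hmp.mono' ((hvm x).norm.pow 2) (.of_forall fun k => by
        rw [Real.norm_of_nonneg (by positivity)]; exact hvsq x k)
    have hv2 : ∀ x, MemLp (v x) 2 ν := fun x =>
      (memLp_two_iff_integrable_sq_norm (hvm x)).2 (hvint x)
    -- the rotated orthonormal family
    set r : K → ℂ := fun k => Complex.exp ((z - 1) * (-(p / 2 * Real.log (m k)) : ℝ)) with hr
    have hrn : ∀ k, ‖r k‖ = 1 := by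
      intro k
      simp only [hr, Complex.norm_exp, Complex.re_mul_ofReal]
      simp [hz]
    have hrm : Measurable r := by fun_prop
    have hh2 : ∀ i, MemLp (fun k => r k * f i k) 2 ν := fun i =>
      (hf2 i).mono (hrm.aestronglyMeasurable.mul (hf2 i).1) (.of_forall fun k => by simp [hrn])
    have hhon : ∀ i j, ∫ k, starRingEnd ℂ (r k * f i k) * (r k * f j k) ∂ν
        = if i = j then 1 else 0 := by
      intro i j
      rw [← hfon i j]
      refine integral_congr_ae (.of_forall fun k => ?_)
      have h1 : starRingEnd ℂ (r k) * r k = 1 := by rw [Complex.conj_mul', hrn]; simp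
      simp only [map_mul]
      linear_combination (starRingEnd ℂ (f i k) * f j k) * h1
    have hSL : ∀ x i, ∫ k, L z i k * e x k ∂ν
        = starRingEnd ℂ (∫ k, starRingEnd ℂ (r k * f i k) * v x k ∂ν) := by
      intro x i
      rw [← integral_conj]
      refine integral_congr_ae (.of_forall fun k => ?_)
      simp only [hL, hr, hv, map_mul, Complex.conj_conj, Complex.conj_ofReal, ← hexpm]
      rw [sub_one_mul, Complex.exp_sub, Complex.ofReal_exp]
      field_simp
    have hbes : ∀ x, ∑ i, ‖∫ k, L z i k * e x k ∂ν‖ ^ 2 ≤ Q := by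
      intro x
      simp only [hSL, RCLike.norm_conj]
      exact (sum_norm_integral_conj_mul_sq_le hh2 hhon (hv2 x)).trans
        (integral_mono (hvint x) hmp (hvsq x))
    have hpt : ∀ i x, ‖wz z x * ∫ k, L z i k * e x k ∂ν‖ ^ 2
        = W x ^ p * ‖∫ k, L z i k * e x k ∂ν‖ ^ 2 := by
      intro i x
      rw [norm_mul, mul_pow, hw1]
    have hvi : ∀ i, Integrable (fun x => ‖wz z x * ∫ k, L z i k * e x k ∂ν‖ ^ 2) μ := by
      intro i
      refine (hWp.mul_const Q).mono' ?_ (.of_forall fun x => ?_)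
      · exact (((hwm z).aestronglyMeasurable.mul (hSm _ (hLm z i))).norm.pow 2)
      · rw [Real.norm_of_nonneg (by positivity), hpt]
        have hn := Real.rpow_nonneg (hW0 x) p
        gcongr
        exact (Finset.single_le_sum (f := fun i => ‖∫ k, L z i k * e x k ∂ν‖ ^ 2)
          (fun i _ => by positivity) (Finset.mem_univ i)).trans (hbes x)
    have hvL : ∀ i, MemLp (fun x => wz z x * ∫ k, L z i k * e x k ∂ν) 2 μ := fun i =>
      (memLp_two_iff_integrable_sq_norm
        ((hwm z).aestronglyMeasurable.mul (hSm _ (hLm z i)))).2 (hvi i)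
    have hsum : ∑ i, ∑ j, ‖F z i j‖ ^ 2 ≤ N * T := by
      rw [Finset.sum_comm]
      calc ∑ i, ∑ j, ‖F z j i‖ ^ 2
          ≤ ∑ i, ∫ x, ‖wz z x * ∫ k, L z i k * e x k ∂ν‖ ^ 2 ∂μ :=
            Finset.sum_le_sum fun i _ => hcol z hzs i (hvL i)
        _ = ∫ x, ∑ i, ‖wz z x * ∫ k, L z i k * e x k ∂ν‖ ^ 2 ∂μ :=
            (integral_finsetSum _ fun i _ => hvi i).symm
        _ ≤ ∫ x, W x ^ p * Q ∂μ := by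
            refine integral_mono (integrable_finsetSum _ fun i _ => hvi i) (hWp.mul_const Q)
              fun x => ?_
            simp only [hpt]
            rw [← Finset.mul_sum]
            have hn := Real.rpow_nonneg (hW0 x) p
            gcongr
            exact hbes x
        _ = N * T := by rw [integral_mul_const, hT]; field_simp
    exact Real.le_sqrt_of_sq_le (Matrix.norm_det_sq_le_of_sum_norm_sq_le _ hsum)
  -- the value at `1 / p`
  have hz1 : ((p⁻¹ : ℝ) : ℂ) ∈ verticalClosedStrip 0 1 := by
    constructor
    · simpa using hp0.le
    · simpa using inv_le_one_of_one_le₀ hp.le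
  have hval : 1 ≤ ‖(F ((p⁻¹ : ℝ) : ℂ)).det‖ := by
    have hdiag : F ((p⁻¹ : ℝ) : ℂ) = Matrix.diagonal fun i => ((√(lam i) : ℝ) : ℂ) := by
      ext j i
      rw [hFiter _ hz1, Matrix.diagonal_apply, ← hgu j i]
      refine integral_congr_ae ?_
      filter_upwards [hrep i] with x hx
      rw [hx]
      have h1 : ∀ k, L ((p⁻¹ : ℝ) : ℂ) i k * e x k = ((√(m k))⁻¹ : ℝ) * f i k * e x k := by
        intro k
        simp only [hL]
        rw [← Complex.ofReal_mul, ← Complex.ofReal_exp, Real.sqrt_eq_rpow,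
          ← Real.rpow_neg (hm0 k).le, Real.rpow_def_of_pos (hm0 k)]
        congr 4
        field_simp
      simp only [h1]
      rcases (hW0 x).eq_or_lt with h | h
      · simp [hg, ← h]
      · have h2 : wz ((p⁻¹ : ℝ) : ℂ) x = ((√(W x) : ℝ) : ℂ) := by
          simp only [hwz, h.ne', if_false]
          rw [← Complex.ofReal_mul, ← Complex.ofReal_exp, Real.sqrt_eq_rpow,
            Real.rpow_def_of_pos h]
          congr 2
          field_simp
        rw [h2]
    rw [hdiag, Matrix.det_diagonal, norm_prod]
    calc (1 : ℝ) = ∏ _i : Fin N, (1 : ℝ) := by simp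
      _ ≤ ∏ i, ‖((√(lam i) : ℝ) : ℂ)‖ := by
        refine Finset.prod_le_prod (fun _ _ => zero_le_one) fun i _ => ?_
        rw [Complex.norm_real, Real.norm_of_nonneg (Real.sqrt_nonneg _)]
        exact Real.one_le_sqrt.2 (hlam i)
  have hFd : ∀ j i, DiffContOnCl ℂ (fun z => F z j i) (verticalStrip 0 1) := fun j i =>
    diffContOnCl_integral_mul_cexp (hcI j i) hsm (hcsI j i)
  have hdiff : DiffContOnCl ℂ (fun z => (F z).det) (verticalStrip 0 1) := by
    constructor
    · simp only [Matrix.det_apply]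
      exact DifferentiableOn.fun_sum fun σ _ => DifferentiableOn.const_smul
        (DifferentiableOn.fun_finsetProd fun i _ => (hFd _ _).differentiableOn) _
    · simp only [Matrix.det_apply]
      exact continuousOn_finsetSum _ fun σ _ => ContinuousOn.const_smul
        (continuousOn_finsetProd _ fun i _ => (hFd _ _).continuousOn) _
  have hbdd : BddAbove ((norm ∘ fun z => (F z).det) '' verticalClosedStrip 0 1) := by
    set B : Fin N → Fin N → ℝ := fun j i => ∫ y, ‖c j i y‖ * (1 + Real.exp (s y)) ∂(μ.prod ν)
      with hB
    refine ⟨√(((∑ j, ∑ i, B j i ^ 2) / N) ^ N), ?_⟩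
    rintro _ ⟨z, hz, rfl⟩
    refine Real.le_sqrt_of_sq_le (Matrix.norm_det_sq_le_of_sum_norm_sq_le _ ?_)
    rw [mul_div_cancel₀ _ hN'.ne']
    gcongr with j _ i _
    refine norm_integral_le_of_norm_le (integrable_norm_mul_one_add_exp (hcI j i) (hcsI j i))
      (.of_forall fun y => ?_)
    rw [norm_mul]
    gcongr
    exact norm_cexp_mul_ofReal_le hz _
  have h3 := norm_le_interp_of_mem_verticalClosedStrip₀₁' _ hz1 hdiff hbdd hdet0 hdet1
  rw [Real.one_rpow, one_mul, Complex.ofReal_re] at h3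
  by_contra! hlt
  have hQ0 : 0 ≤ Q := integral_nonneg fun k => Real.rpow_nonneg (hm0 k).le _
  have hT0 : 0 ≤ T := by
    have h1 : 0 ≤ ∫ x, W x ^ p ∂μ := integral_nonneg fun x => Real.rpow_nonneg (hW0 x) _
    positivity
  have hT1 : T < 1 := by rw [hT, div_lt_one hN']; exact hlt
  have h4 : √(T ^ N) < 1 := by
    rw [Real.sqrt_lt' one_pos, one_pow]
    exact pow_lt_one₀ hT0 hT1 hN.ne'
  have h5 : √(T ^ N) ^ p⁻¹ < 1 := Real.rpow_lt_one (Real.sqrt_nonneg _) h4 (by positivity)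
  linarith [hval.trans h3]

open FourierTransform in
theorem Real.memLp_fourierInv_and_lintegral_enorm_sq {f : ℝ → ℂ} (hf1 : Integrable f)
    (hf2 : MemLp f 2) :
    MemLp (𝓕⁻ f) 2 ∧ ∫⁻ x, ‖𝓕⁻ f x‖ₑ ^ 2 = ∫⁻ x, ‖f x‖ₑ ^ 2 := by
  set G : Lp ℂ 2 (volume : Measure ℝ) := 𝓕⁻ (hf2.toLp f) with hG
  have hFG : 𝓕 G = hf2.toLp f := by rw [hG, FourierTransform.fourier_fourierInv_eq]
  have hcont : Continuous (𝓕⁻ f) :=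
    VectorFourier.fourierIntegral_continuous Real.continuous_fourierChar
      (by fun_prop) hf1
  have hae : ∀ᵐ x, (G : ℝ → ℂ) x = 𝓕⁻ f x := by
    refine ae_eq_of_integral_contDiff_smul_eq
      ((Lp.memLp G).locallyIntegrable (by norm_num)) hcont.locallyIntegrable fun g hg hgs => ?_
    have hgC : ContDiff ℝ (⊤ : ℕ∞) (fun x => (g x : ℂ)) := Complex.ofRealCLM.contDiff.comp hg
    have hgsC : HasCompactSupport (fun x => (g x : ℂ)) := hgs.comp_left Complex.ofReal_zero
    set φ := hgsC.toSchwartzMap hgC with hφ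
    have h1 : inner ℂ (φ.toLp 2) G = ∫ x, g x • (G : ℝ → ℂ) x := by
      rw [L2.inner_def]
      refine integral_congr_ae ?_
      filter_upwards [φ.coeFn_toLp 2 volume] with x hx
      rw [hx]
      simp [hφ, mul_comm]
    have h2 : inner ℂ (φ.toLp 2) G = ∫ x, inner ℂ (𝓕 (φ : ℝ → ℂ) x) (f x) := by
      rw [← Lp.inner_fourier_eq, hFG, SchwartzMap.toLp_fourier_eq, L2.inner_def]
      refine integral_congr_ae ?_
      filter_upwards [(𝓕 φ).coeFn_toLp 2 volume, hf2.coeFn_toLp] with x hx hx2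
      rw [hx, hx2, SchwartzMap.fourier_coe]
    have h3 : ∫ x, inner ℂ (𝓕 (φ : ℝ → ℂ) x) (f x) = ∫ x, inner ℂ (φ x) (𝓕⁻ f x) := by
      have h4 := VectorFourier.integral_sesq_fourierIntegral_eq_neg_flip (μ := (volume : Measure ℝ))
        (ν := (volume : Measure ℝ)) (L := innerₗ ℝ) (innerSL ℂ)
        Real.continuous_fourierChar (by fun_prop) φ.integrable hf1
      rwa [flip_innerₗ] at h4
    rw [← h1, h2, h3]
    refine integral_congr_ae (.of_forall fun x => ?_)
    simp [hφ, mul_comm]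
  have hmem : MemLp (𝓕⁻ f) 2 := (memLp_congr_ae hae).1 (Lp.memLp G)
  refine ⟨hmem, ?_⟩
  have hnorm : eLpNorm (𝓕⁻ f) 2 volume = eLpNorm f 2 volume := by
    rw [← eLpNorm_congr_ae hae, ← Lp.enorm_def, ← eLpNorm_congr_ae hf2.coeFn_toLp, ← Lp.enorm_def,
      ← ofReal_norm, ← ofReal_norm, ← hFG, Lp.norm_fourier_eq]
  have h2 : ∀ h : ℝ → ℂ, ∫⁻ x, ‖h x‖ₑ ^ 2 = eLpNorm h 2 volume ^ 2 := by
    intro h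
    rw [eLpNorm_eq_lintegral_rpow_enorm_toReal (by norm_num) (by norm_num), ← ENNReal.rpow_natCast,
      ← ENNReal.rpow_mul]
    simp
  rw [h2, h2, hnorm]

theorem hasSum_norm_sq_of_hasSum_fourier {T : ℝ} [hT : Fact (0 < T)] {c : ℤ → ℂ}
    {g : C(AddCircle T, ℂ)} (hg : HasSum (fun n => c n • fourier n) g) :
    HasSum (fun n => ‖c n‖ ^ 2) (∫ t, ‖g t‖ ^ 2 ∂AddCircle.haarAddCircle) := by
  set G := ContinuousMap.toLp (E := ℂ) 2 AddCircle.haarAddCircle ℂ g with hG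
  have hGs : HasSum (fun n => c n • fourierLp (T := T) 2 n) G := by
    have := hg.mapL (ContinuousMap.toLp (E := ℂ) 2 AddCircle.haarAddCircle ℂ)
    simpa [fourierLp] using this
  have hcoef : ∀ n, fourierCoeff G n = c n := by
    intro n
    rw [← fourierBasis_repr, HilbertBasis.repr_apply_apply, coe_fourierBasis]
    have h1 := hGs.mapL (innerSL ℂ (fourierLp (T := T) 2 n))
    have h2 : ∀ k, innerSL ℂ (fourierLp (T := T) 2 n) (c k • fourierLp (T := T) 2 k)
        = if k = n then c n else 0 := by
      intro k
      rw [innerSL_apply_apply, inner_smul_right, orthonormal_iff_ite.1 orthonormal_fourier n k]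
      by_cases h : k = n
      · simp [h]
      · simp [h, Ne.symm h]
    simp only [h2] at h1
    exact h1.unique (hasSum_ite_eq n (c n))
  have h3 := hasSum_sq_fourierCoeff G
  simp only [hcoef] at h3
  convert h3 using 1
  refine integral_congr_ae ?_
  filter_upwards [ContinuousMap.coeFn_toLp (E := ℂ) (p := 2) (𝕜 := ℂ) AddCircle.haarAddCircle g]
    with x hx
  rw [hG, hx]

theorem lintegral_enorm_tsum_exp_sq {c : ℤ → ℂ} (hc : Summable fun n => ‖c n‖) :
    ∫⁻ θ in Set.Ioc (-Real.pi) Real.pi, ‖∑' n : ℤ, c n * Complex.exp (Complex.I * (n * θ))‖ₑ ^ 2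
      = ENNReal.ofReal (2 * Real.pi) * ∑' n, ‖c n‖ₑ ^ 2 := by
  have hT : Fact (0 < 2 * Real.pi) := ⟨Real.two_pi_pos⟩
  have hsum : Summable fun n => c n • fourier (T := 2 * Real.pi) n := by
    refine Summable.of_norm ?_
    simpa [norm_smul, fourier_norm] using hc
  obtain ⟨g, hg⟩ := hsum
  have hgt : ∀ θ : ℝ, ∑' n : ℤ, c n * Complex.exp (Complex.I * (n * θ))
      = g (θ : AddCircle (2 * Real.pi)) := by
    intro θ
    have h1 := (ContinuousMap.evalCLM ℂ (θ : AddCircle (2 * Real.pi))).hasSum hg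
    refine Eq.trans ?_ h1.tsum_eq
    refine tsum_congr fun n => ?_
    simp only [ContinuousMap.evalCLM_apply, ContinuousMap.smul_apply, smul_eq_mul,
      fourier_coe_apply]
    congr 2
    push_cast
    have : (Real.pi : ℂ) ≠ 0 := by exact_mod_cast Real.pi_ne_zero
    field_simp
  simp only [hgt]
  have h2 := AddCircle.lintegral_preimage (2 * Real.pi) (-Real.pi) (fun t => ‖g t‖ₑ ^ 2)
  rw [show -Real.pi + 2 * Real.pi = Real.pi by ring] at h2
  rw [h2, AddCircle.volume_eq_smul_haarAddCircle, lintegral_smul_measure, smul_eq_mul]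
  congr 1
  have h3 := hasSum_norm_sq_of_hasSum_fourier hg
  have h4 : ∀ z : ℂ, ‖z‖ₑ ^ 2 = ENNReal.ofReal (‖z‖ ^ 2) := by
    intro z
    rw [ENNReal.ofReal_pow (norm_nonneg _), ofReal_norm]
  simp only [h4]
  rw [← ENNReal.ofReal_tsum_of_nonneg (fun n => by positivity) h3.summable, h3.tsum_eq,
    ofReal_integral_eq_lintegral_ofReal]
  · exact ((map_continuous g).norm.pow 2).integrable_of_hasCompactSupport
      (HasCompactSupport.of_compactSpace _)
  · exact .of_forall fun t => by positivity

/-- The measure `dt dθ / 2π` on the cylinder `ℝ × (-π, π]`. -/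
noncomputable def cylMeasure : Measure (ℝ × ℝ) :=
  (volume : Measure ℝ).prod
    (ENNReal.ofReal (2 * Real.pi)⁻¹ • volume.restrict (Set.Ioc (-Real.pi) Real.pi))

/-- Counting measure times Lebesgue measure, on the dual group `ℤ × ℝ` of the cylinder. -/
noncomputable def dualMeasure : Measure (ℤ × ℝ) :=
  (Measure.count : Measure ℤ).prod volume

instance : SFinite cylMeasure := by unfold cylMeasure; infer_instance
instance : SFinite dualMeasure := by unfold dualMeasure; infer_instance

/-- The characters of the cylinder. -/
noncomputable def cylWave (x : ℝ × ℝ) (k : ℤ × ℝ) : ℂ :=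
  Complex.exp (Complex.I * ((k.1 * x.2 + 2 * Real.pi * x.1 * k.2 : ℝ) : ℂ))

theorem norm_cylWave (x : ℝ × ℝ) (k : ℤ × ℝ) : ‖cylWave x k‖ = 1 := by
  rw [cylWave, mul_comm, Complex.norm_exp_ofReal_mul_I]

theorem measurable_cylWave : Measurable (Function.uncurry cylWave) := by
  unfold cylWave Function.uncurry
  fun_prop

theorem lintegral_dualMeasure {f : ℤ × ℝ → ENNReal} (hf : AEMeasurable f dualMeasure) :
    ∫⁻ k, f k ∂dualMeasure = ∑' n : ℤ, ∫⁻ ξ, f (n, ξ) := by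
  rw [dualMeasure, lintegral_prod _ hf, lintegral_count]

theorem Integrable.dualMeasure_slice {E : Type*} [NormedAddCommGroup E] {f : ℤ × ℝ → E}
    (hf : Integrable f dualMeasure) (n : ℤ) : Integrable (fun ξ => f (n, ξ)) := by
  have h := hf.prod_right_ae
  rw [Measure.ae_count_iff] at h
  exact h n

theorem Integrable.summable_dualMeasure {E : Type*} [NormedAddCommGroup E] {f : ℤ × ℝ → E}
    (hf : Integrable f dualMeasure) : Summable fun n => ∫ ξ, ‖f (n, ξ)‖ := by
  have h := hf.integral_norm_prod_left
  rw [integrable_count_iff] at h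
  refine h.congr fun n => ?_
  rw [Real.norm_of_nonneg (integral_nonneg fun _ => norm_nonneg _)]

theorem hasSum_integral_dualMeasure {E : Type*} [NormedAddCommGroup E] [NormedSpace ℝ E]
    [CompleteSpace E] {f : ℤ × ℝ → E} (hf : Integrable f dualMeasure) :
    HasSum (fun n => ∫ ξ, f (n, ξ)) (∫ k, f k ∂dualMeasure) := by
  have h := hf.integral_prod_left
  have h1 : Summable fun n => ∫ ξ, f (n, ξ) :=
    (Integrable.summable_dualMeasure hf).of_norm_bounded fun n => norm_integral_le_integral_norm _
  convert h1.hasSum using 1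
  rw [dualMeasure, integral_prod _ hf, integral_countable h]
  simp [Measure.real]

open FourierTransform in
theorem integral_mul_cylWave {h : ℤ × ℝ → ℂ} (hh : Integrable h dualMeasure) (x : ℝ × ℝ) :
    ∫ k, h k * cylWave x k ∂dualMeasure =
      ∑' n : ℤ, 𝓕⁻ (fun ξ => h (n, ξ)) x.1 * Complex.exp (Complex.I * (n * x.2)) := by
  have hi : Integrable (fun k => h k * cylWave x k) dualMeasure := by
    refine hh.mul_bdd (c := 1) ?_ (.of_forall fun k => (norm_cylWave x k).le)
    exact (measurable_cylWave.comp measurable_prodMk_left).aestronglyMeasurable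
  rw [← (hasSum_integral_dualMeasure hi).tsum_eq]
  refine tsum_congr fun n => ?_
  rw [Real.fourierInv_eq', ← integral_mul_const]
  refine integral_congr_ae (.of_forall fun ξ => ?_)
  simp only [cylWave, smul_eq_mul, RCLike.inner_apply, conj_trivial]
  conv_rhs => rw [mul_right_comm, ← Complex.exp_add, mul_comm]
  congr 2
  push_cast
  ring

theorem continuous_integral_mul_cylWave {h : ℤ × ℝ → ℂ} (hh : Integrable h dualMeasure) :
    Continuous fun x => ∫ k, h k * cylWave x k ∂dualMeasure := by
  refine continuous_of_dominated (bound := fun k => ‖h k‖) (fun x => ?_)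
    (fun x => .of_forall fun k => ?_) hh.norm (.of_forall fun k => ?_)
  · exact hh.aestronglyMeasurable.mul
      (measurable_cylWave.comp measurable_prodMk_left).aestronglyMeasurable
  · simp [norm_cylWave]
  · unfold cylWave
    fun_prop

open FourierTransform in
theorem lintegral_enorm_integral_mul_cylWave_sq {h : ℤ × ℝ → ℂ} (h1 : Integrable h dualMeasure)
    (h2 : MemLp h 2 dualMeasure) :
    ∫⁻ x, ‖∫ k, h k * cylWave x k ∂dualMeasure‖ₑ ^ 2 ∂cylMeasure =
      ∫⁻ k, ‖h k‖ₑ ^ 2 ∂dualMeasure := by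
  have hsl := fun n => Integrable.dualMeasure_slice h1 n
  have hslm : ∀ n, MemLp (fun ξ => h (n, ξ)) 2 := by
    intro n
    refine (memLp_two_iff_integrable_sq_norm (hsl n).aestronglyMeasurable).2 ?_
    exact Integrable.dualMeasure_slice
      ((memLp_two_iff_integrable_sq_norm h1.aestronglyMeasurable).1 h2) n
  have hcont := (continuous_integral_mul_cylWave h1).measurable
  rw [lintegral_dualMeasure (h1.aestronglyMeasurable.enorm.pow_const 2), cylMeasure,
    lintegral_prod _ (hcont.enorm.pow_const 2).aemeasurable]
  have hcontn : ∀ n, Continuous (𝓕⁻ fun ξ => h (n, ξ)) := fun n =>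
    VectorFourier.fourierIntegral_continuous Real.continuous_fourierChar (by fun_prop) (hsl n)
  have key : ∀ t : ℝ, ∫⁻ θ, ‖∫ k, h k * cylWave (t, θ) k ∂dualMeasure‖ₑ ^ 2
      ∂(ENNReal.ofReal (2 * Real.pi)⁻¹ • volume.restrict (Set.Ioc (-Real.pi) Real.pi)) =
      ∑' n : ℤ, ‖𝓕⁻ (fun ξ => h (n, ξ)) t‖ₑ ^ 2 := by
    intro t
    simp only [integral_mul_cylWave h1]
    rw [lintegral_smul_measure, lintegral_enorm_tsum_exp_sq, smul_eq_mul, ← mul_assoc,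
      ← ENNReal.ofReal_mul (by positivity), inv_mul_cancel₀ (by positivity), ENNReal.ofReal_one,
      one_mul]
    refine (Integrable.summable_dualMeasure h1).of_nonneg_of_le (fun n => norm_nonneg _) fun n => ?_
    exact VectorFourier.norm_fourierIntegral_le_integral_norm _ _ _ _ _
  simp only [key]
  rw [lintegral_tsum fun n => ((hcontn n).measurable.enorm.pow_const 2).aemeasurable]
  exact tsum_congr fun n => (Real.memLp_fourierInv_and_lintegral_enorm_sq (hsl n) (hslm n)).2

theorem memLp_two_iff_lintegral {X : Type*} [MeasurableSpace X] {μ : Measure X} {f : X → ℂ}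
    (hf : AEStronglyMeasurable f μ) : MemLp f 2 μ ↔ ∫⁻ x, ‖f x‖ₑ ^ 2 ∂μ < ⊤ := by
  rw [MemLp, and_iff_right hf,
    eLpNorm_lt_top_iff_lintegral_rpow_enorm_lt_top (by norm_num) (by norm_num)]
  simp

theorem memLp_integral_mul_cylWave {h : ℤ × ℝ → ℂ} (h1 : Integrable h dualMeasure)
    (h2 : MemLp h 2 dualMeasure) :
    MemLp (fun x => ∫ k, h k * cylWave x k ∂dualMeasure) 2 cylMeasure ∧
      ∫ x, ‖∫ k, h k * cylWave x k ∂dualMeasure‖ ^ 2 ∂cylMeasure = ∫ k, ‖h k‖ ^ 2 ∂dualMeasure := by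
  have hm := (continuous_integral_mul_cylWave h1).aestronglyMeasurable (μ := cylMeasure)
  have h3 := lintegral_enorm_integral_mul_cylWave_sq h1 h2
  refine ⟨?_, ?_⟩
  · rw [memLp_two_iff_lintegral hm, h3]
    exact (memLp_two_iff_lintegral h1.aestronglyMeasurable).1 h2
  · rw [integral_eq_lintegral_of_nonneg_ae (.of_forall fun _ => by positivity)
      (hm.norm.fun_pow 2), integral_eq_lintegral_of_nonneg_ae (.of_forall fun _ => by positivity)
      (h1.aestronglyMeasurable.norm.fun_pow 2)]
    have h4 : ∀ z : ℂ, ENNReal.ofReal (‖z‖ ^ 2) = ‖z‖ₑ ^ 2 := by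
      intro z
      rw [ENNReal.ofReal_pow (norm_nonneg _), ofReal_norm]
    simp only [h4, h3]

theorem lintegral_rpow_mul_exp_neg_mul_Ioi {a r : ℝ} (ha : 0 < a) (hr : 0 < r) :
    ∫⁻ t in Set.Ioi (0 : ℝ), ENNReal.ofReal (t ^ (a - 1) * Real.exp (-(r * t))) =
      ENNReal.ofReal (r ^ (-a) * Real.Gamma a) := by
  have h := Real.integral_rpow_mul_exp_neg_mul_Ioi ha hr
  have hpos : 0 < (1 / r) ^ a * Real.Gamma a :=
    mul_pos (Real.rpow_pos_of_pos (by positivity) _) (Real.Gamma_pos_of_pos ha)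
  rw [← ofReal_integral_eq_lintegral_ofReal, h, one_div, Real.inv_rpow hr.le, Real.rpow_neg hr.le]
  · exact Integrable.of_integral_ne_zero (h ▸ hpos.ne')
  · refine (ae_restrict_iff' measurableSet_Ioi).2 (.of_forall fun t ht => ?_)
    have : (0 : ℝ) < t := ht
    positivity

theorem lintegral_exp_neg_mul_sq {b : ℝ} (hb : 0 < b) :
    ∫⁻ x : ℝ, ENNReal.ofReal (Real.exp (-b * x ^ 2)) = ENNReal.ofReal (√(Real.pi / b)) := by
  rw [← ofReal_integral_eq_lintegral_ofReal (integrable_exp_neg_mul_sq hb)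
    (.of_forall fun _ => (Real.exp_pos _).le), integral_gaussian]

theorem lintegral_two_pi_mul_sq_add_sq_rpow {q a : ℝ} (hq : 1 / 2 < q) (ha : a ≠ 0) :
    ∫⁻ ξ : ℝ, ENNReal.ofReal (((2 * Real.pi * ξ) ^ 2 + a ^ 2) ^ (-q)) =
      ENNReal.ofReal (Real.Gamma (q - 1 / 2) / (2 * √Real.pi * Real.Gamma q) *
        |a| ^ (1 - 2 * q)) := by
  have hq0 : 0 < q := by linarith
  have hG := Real.Gamma_pos_of_pos hq0
  have ha2 : 0 < a ^ 2 := by positivity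
  have h1 : ∀ ξ : ℝ, ENNReal.ofReal (((2 * Real.pi * ξ) ^ 2 + a ^ 2) ^ (-q)) =
      ENNReal.ofReal (Real.Gamma q)⁻¹ * ∫⁻ t in Set.Ioi (0 : ℝ), ENNReal.ofReal
        (t ^ (q - 1) * Real.exp (-(((2 * Real.pi * ξ) ^ 2 + a ^ 2) * t))) := by
    intro ξ
    rw [lintegral_rpow_mul_exp_neg_mul_Ioi hq0 (by positivity),
      ← ENNReal.ofReal_mul (by positivity)]
    congr 1
    field_simp
  simp only [h1]
  rw [lintegral_const_mul' _ _ ENNReal.ofReal_ne_top, lintegral_lintegral_swap (by fun_prop)]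
  have h2 : ∀ t ∈ Set.Ioi (0 : ℝ), ∫⁻ ξ : ℝ, ENNReal.ofReal
        (t ^ (q - 1) * Real.exp (-(((2 * Real.pi * ξ) ^ 2 + a ^ 2) * t))) =
      ENNReal.ofReal (2 * √Real.pi)⁻¹ *
        ENNReal.ofReal (t ^ (q - 1 / 2 - 1) * Real.exp (-(a ^ 2 * t))) := by
    intro t ht
    have ht0 : 0 < t := ht
    have h3 : ∀ ξ : ℝ, ENNReal.ofReal
        (t ^ (q - 1) * Real.exp (-(((2 * Real.pi * ξ) ^ 2 + a ^ 2) * t))) =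
        ENNReal.ofReal (t ^ (q - 1) * Real.exp (-(a ^ 2 * t))) *
          ENNReal.ofReal (Real.exp (-(4 * Real.pi ^ 2 * t) * ξ ^ 2)) := by
      intro ξ
      rw [← ENNReal.ofReal_mul (by positivity), mul_assoc (t ^ (q - 1)), ← Real.exp_add]
      congr 3
      ring
    simp only [h3]
    rw [lintegral_const_mul' _ _ ENNReal.ofReal_ne_top, lintegral_exp_neg_mul_sq (by positivity),
      ← ENNReal.ofReal_mul (by positivity), ← ENNReal.ofReal_mul (by positivity)]
    congr 1
    have h4 : √(Real.pi / (4 * Real.pi ^ 2 * t)) = (2 * √Real.pi)⁻¹ * t ^ (-(1 / 2) : ℝ) := by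
      rw [Real.rpow_neg ht0.le, ← Real.sqrt_eq_rpow,
        show Real.pi / (4 * Real.pi ^ 2 * t) = ((2 * √Real.pi)⁻¹ * (√t)⁻¹) ^ 2 by
          rw [mul_pow, inv_pow, inv_pow, mul_pow, Real.sq_sqrt Real.pi_pos.le, Real.sq_sqrt ht0.le]
          field_simp
          norm_num]
      exact Real.sqrt_sq (by positivity)
    rw [h4, show q - 1 / 2 - 1 = (q - 1) + -(1 / 2) by ring, Real.rpow_add ht0]
    ring
  rw [setLIntegral_congr_fun measurableSet_Ioi h2, lintegral_const_mul' _ _ ENNReal.ofReal_ne_top,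
    lintegral_rpow_mul_exp_neg_mul_Ioi (by linarith) ha2, ← ENNReal.ofReal_mul (by positivity),
    ← ENNReal.ofReal_mul (by positivity)]
  congr 1
  rw [← sq_abs, ← Real.rpow_natCast, ← Real.rpow_mul (abs_nonneg a),
    show ((2 : ℕ) : ℝ) * -(q - 1 / 2) = 1 - 2 * q by push_cast; ring]
  field_simp

/-- The symbol of the Aharonov–Bohm operator in logarithmic polar coordinates. -/
noncomputable def cylSymbol (Φ : ℝ) (k : ℤ × ℝ) : ℝ := (2 * Real.pi * k.2) ^ 2 + (k.1 - Φ) ^ 2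

theorem measurable_cylSymbol (Φ : ℝ) : Measurable (cylSymbol Φ) := by
  unfold cylSymbol
  fun_prop

theorem exists_pos_le_cylSymbol {Φ : ℝ} (hΦ : ∀ k : ℤ, Φ ≠ k) :
    ∃ δ > 0, ∀ k, δ ≤ cylSymbol Φ k := by
  refine ⟨(round Φ - Φ) ^ 2, ?_, fun k => ?_⟩
  · have := sub_ne_zero.2 (hΦ (round Φ)).symm
    positivity
  · have h := round_le Φ k.1
    rw [abs_sub_comm, abs_sub_comm Φ] at h
    have := sq_le_sq.2 h
    unfold cylSymbol
    nlinarith [sq_nonneg (2 * Real.pi * k.2)]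

theorem integrable_cylSymbol_rpow {Φ : ℝ} (hΦ : ∀ k : ℤ, Φ ≠ k) {q : ℝ} (hq : 1 < q) :
    Integrable (fun k => cylSymbol Φ k ^ (-q)) dualMeasure ∧
      ∫ k, cylSymbol Φ k ^ (-q) ∂dualMeasure =
        Real.Gamma (q - 1 / 2) / (2 * √Real.pi * Real.Gamma q) *
          ∑' n : ℤ, |(n : ℝ) - Φ| ^ (1 - 2 * q) := by
  have hm : Measurable fun k => cylSymbol Φ k ^ (-q) :=
    (measurable_cylSymbol Φ).pow_const _
  have hnn : ∀ k, 0 ≤ cylSymbol Φ k ^ (-q) := fun k => by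
    unfold cylSymbol
    positivity
  have hc : 0 ≤ Real.Gamma (q - 1 / 2) / (2 * √Real.pi * Real.Gamma q) := by
    have := Real.Gamma_pos_of_pos (show 0 < q by linarith)
    have := Real.Gamma_pos_of_pos (show 0 < q - 1 / 2 by linarith)
    positivity
  have hsum : Summable fun n : ℤ => |(n : ℝ) - Φ| ^ (1 - 2 * q) := by
    have := (Real.summable_one_div_int_add_rpow (-Φ) (2 * q - 1)).2 (by linarith)
    refine this.congr fun n => ?_
    rw [one_div, ← Real.rpow_neg (abs_nonneg _), ← sub_eq_add_neg]
    congr 1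
    ring
  have hl : ∫⁻ k, ENNReal.ofReal (cylSymbol Φ k ^ (-q)) ∂dualMeasure = ENNReal.ofReal
      (Real.Gamma (q - 1 / 2) / (2 * √Real.pi * Real.Gamma q) *
          ∑' n : ℤ, |(n : ℝ) - Φ| ^ (1 - 2 * q)) := by
    rw [lintegral_dualMeasure hm.ennreal_ofReal.aemeasurable, ← tsum_mul_left,
      ENNReal.ofReal_tsum_of_nonneg (fun n => by positivity) (hsum.mul_left _)]
    refine tsum_congr fun n => ?_
    exact lintegral_two_pi_mul_sq_add_sq_rpow (by linarith) (sub_ne_zero.2 (hΦ n).symm)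
  refine ⟨⟨hm.aestronglyMeasurable, ?_⟩, ?_⟩
  · rw [hasFiniteIntegral_iff_ofReal (.of_forall hnn), hl]
    exact ENNReal.ofReal_lt_top
  · rw [integral_eq_lintegral_of_nonneg_ae (.of_forall hnn) hm.aestronglyMeasurable, hl,
      ENNReal.toReal_ofReal (mul_nonneg hc (tsum_nonneg fun n => by positivity))]

/-- Smooth functions on the cylinder `ℝ × ℝ/2πℤ` vanishing near both ends. -/
structure IsCylTest (v : ℝ × ℝ → ℂ) : Prop where
  contDiff : ContDiff ℝ (⊤ : ℕ∞) v
  periodic : ∀ t θ, v (t, θ + 2 * Real.pi) = v (t, θ)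
  exists_support : ∃ R : ℝ, ∀ t θ, R < |t| → v (t, θ) = 0

namespace IsCylTest

theorem fderiv_apply {v : ℝ × ℝ → ℂ} (hv : IsCylTest v) (w : ℝ × ℝ) :
    IsCylTest fun x => fderiv ℝ v x w := by
  refine ⟨(hv.contDiff.fderiv_right (m := (⊤ : ℕ∞)) (by simp)).clm_apply contDiff_const, ?_, ?_⟩
  · intro t θ
    have h : (fun x => v (x + (0, 2 * Real.pi))) = v := by
      ext ⟨a, b⟩
      simpa using hv.periodic a b
    have h2 := fderiv_comp_add_right (𝕜 := ℝ) (f := v) (x := (t, θ)) (0, 2 * Real.pi)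
    rw [h] at h2
    simp only [Prod.mk_add_mk, add_zero] at h2
    rw [h2]
  · obtain ⟨R, hR⟩ := hv.exists_support
    refine ⟨R, fun t θ ht => ?_⟩
    have h : v =ᶠ[nhds (t, θ)] fun _ => 0 := by
      have ho : IsOpen {x : ℝ × ℝ | R < |x.1|} := isOpen_lt continuous_const (by fun_prop)
      filter_upwards [ho.mem_nhds ht] with x hx
      exact hR x.1 x.2 hx
    rw [h.fderiv_eq]
    simp

theorem const_mul {v : ℝ × ℝ → ℂ} (hv : IsCylTest v) (c : ℂ) : IsCylTest fun x => c * v x := by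
  refine ⟨contDiff_const.mul hv.contDiff, fun t θ => by rw [hv.periodic], ?_⟩
  obtain ⟨R, hR⟩ := hv.exists_support
  exact ⟨R, fun t θ ht => by rw [hR t θ ht, mul_zero]⟩

theorem sub {v w : ℝ × ℝ → ℂ} (hv : IsCylTest v) (hw : IsCylTest w) :
    IsCylTest fun x => v x - w x := by
  refine ⟨hv.contDiff.sub hw.contDiff, fun t θ => by rw [hv.periodic, hw.periodic], ?_⟩
  obtain ⟨R, hR⟩ := hv.exists_support
  obtain ⟨S, hS⟩ := hw.exists_support
  exact ⟨max R S, fun t θ ht => by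
    rw [hR t θ ((le_max_left _ _).trans_lt ht), hS t θ ((le_max_right _ _).trans_lt ht), sub_zero]⟩

theorem mul_cylWave {v : ℝ × ℝ → ℂ} (hv : IsCylTest v) (k : ℤ × ℝ) :
    IsCylTest fun x => v x * cylWave x k := by
  refine ⟨hv.contDiff.mul ?_, fun t θ => ?_, ?_⟩
  · unfold cylWave
    refine Complex.contDiff_exp.comp (contDiff_const.mul (Complex.ofRealCLM.contDiff.comp ?_))
    exact (contDiff_const.mul contDiff_snd).add
      ((contDiff_const.mul contDiff_fst).mul contDiff_const)
  · rw [hv.periodic]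
    congr 1
    unfold cylWave
    refine Eq.trans ?_ (Complex.exp_periodic.int_mul k.1 _)
    congr 1
    push_cast
    ring
  · obtain ⟨R, hR⟩ := hv.exists_support
    exact ⟨R, fun t θ ht => by rw [hR t θ ht, zero_mul]⟩

end IsCylTest

theorem cylMeasure_eq : cylMeasure = ENNReal.ofReal (2 * Real.pi)⁻¹ •
    volume.restrict (Set.univ ×ˢ Set.Ioc (-Real.pi) Real.pi) := by
  rw [cylMeasure, Measure.prod_smul_right, Measure.volume_eq_prod, ← Measure.prod_restrict,
    Measure.restrict_univ]

theorem integrable_cylMeasure_of_continuous {E : Type*} [NormedAddCommGroup E] {g : ℝ × ℝ → E}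
    (hg : Continuous g) {R : ℝ} (hR : ∀ t θ, R < |t| → g (t, θ) = 0) :
    Integrable g cylMeasure := by
  rw [cylMeasure_eq]
  refine Integrable.smul_measure ?_ ENNReal.ofReal_ne_top
  have h1 : IntegrableOn g (Set.Icc (-R) R ×ˢ Set.Icc (-Real.pi) Real.pi) :=
    hg.continuousOn.integrableOn_compact (isCompact_Icc.prod isCompact_Icc)
  refine h1.of_forall_sdiff_eq_zero (MeasurableSet.univ.prod measurableSet_Ioc) ?_
  rintro ⟨t, θ⟩ ⟨hx, hx2⟩
  refine hR t θ ?_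
  by_contra hlt
  refine hx2 ⟨abs_le.1 (not_lt.1 hlt), Set.Ioc_subset_Icc_self hx.2⟩

theorem IsCylTest.integrable {v : ℝ × ℝ → ℂ} (hv : IsCylTest v) : Integrable v cylMeasure := by
  obtain ⟨R, hR⟩ := hv.exists_support
  exact integrable_cylMeasure_of_continuous hv.contDiff.continuous hR

theorem IsCylTest.integrable_norm_sq {v : ℝ × ℝ → ℂ} (hv : IsCylTest v) :
    Integrable (fun x => ‖v x‖ ^ 2) cylMeasure := by
  obtain ⟨R, hR⟩ := hv.exists_support
  refine integrable_cylMeasure_of_continuous (hv.contDiff.continuous.norm.pow 2) (R := R) ?_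
  intro t θ ht
  simp [hR t θ ht]

theorem IsCylTest.exists_norm_le {v : ℝ × ℝ → ℂ} (hv : IsCylTest v) : ∃ C, ∀ x, ‖v x‖ ≤ C := by
  obtain ⟨R, hR⟩ := hv.exists_support
  obtain ⟨C, hC⟩ := (isCompact_Icc.prod isCompact_Icc).exists_bound_of_continuousOn
    (s := Set.Icc (-R) R ×ˢ Set.Icc 0 (2 * Real.pi)) hv.contDiff.continuous.continuousOn
  refine ⟨max C 0, fun ⟨t, θ⟩ => ?_⟩
  rcases lt_or_ge R |t| with ht | ht
  · simp [hR t θ ht]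
  · have hper : Function.Periodic (fun s => v (t, s)) (2 * Real.pi) := hv.periodic t
    obtain ⟨s, hs, hs2⟩ := hper.exists_mem_Ico₀ Real.two_pi_pos θ
    rw [show v (t, θ) = v (t, s) from hs2]
    exact (hC (t, s) ⟨abs_le.1 ht, Set.Ico_subset_Icc_self hs⟩).trans (le_max_left _ _)

theorem IsCylTest.integral_fderiv_fst {v : ℝ × ℝ → ℂ} (hv : IsCylTest v) :
    ∫ x, fderiv ℝ v x (1, 0) ∂cylMeasure = 0 := by
  have hi := (hv.fderiv_apply (1, 0)).integrable
  rw [cylMeasure] at hi ⊢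
  rw [integral_prod_symm _ hi]
  refine integral_eq_zero_of_ae (.of_forall fun θ => ?_)
  obtain ⟨R, hR⟩ := hv.exists_support
  have hd : ∀ t, HasDerivAt (fun t => v (t, θ)) (fderiv ℝ v (t, θ) (1, 0)) t := by
    intro t
    have h1 := (hv.contDiff.differentiable (by simp) (t, θ)).hasFDerivAt
    exact h1.comp_hasDerivAt t ((hasDerivAt_id t).prodMk (hasDerivAt_const t θ))
  have hcs : ∀ g : ℝ → ℂ, (∀ t, R < |t| → g t = 0) → HasCompactSupport g := by
    intro g hg
    refine HasCompactSupport.of_support_subset_isCompact (isCompact_Icc (a := -R) (b := R)) ?_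
    intro t ht
    by_contra h
    exact ht (hg t (by by_contra h2; exact h (abs_le.1 (not_lt.1 h2))))
  have hc : Continuous fun t => v (t, θ) := hv.contDiff.continuous.comp (by fun_prop)
  have hc' : Continuous fun t => fderiv ℝ v (t, θ) (1, 0) :=
    (hv.fderiv_apply (1, 0)).contDiff.continuous.comp (by fun_prop)
  have hs' : ∀ t, R < |t| → fderiv ℝ v (t, θ) (1, 0) = 0 := by
    intro t ht
    have hz : (fun t => v (t, θ)) =ᶠ[nhds t] fun _ => 0 := by
      filter_upwards [(isOpen_lt continuous_const continuous_abs).mem_nhds ht] with s hs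
      exact hR s θ hs
    exact (hd t).unique ((hasDerivAt_const t (0 : ℂ)).congr_of_eventuallyEq hz)
  exact integral_eq_zero_of_hasDerivAt_of_integrable hd
    (hc'.integrable_of_hasCompactSupport (hcs _ hs'))
    (hc.integrable_of_hasCompactSupport (hcs _ fun t => hR t θ))

theorem IsCylTest.integral_fderiv_snd {v : ℝ × ℝ → ℂ} (hv : IsCylTest v) :
    ∫ x, fderiv ℝ v x (0, 1) ∂cylMeasure = 0 := by
  have hi := (hv.fderiv_apply (0, 1)).integrable
  rw [cylMeasure] at hi ⊢
  rw [integral_prod _ hi]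
  refine integral_eq_zero_of_ae (.of_forall fun t => ?_)
  have hd : ∀ θ, HasDerivAt (fun θ => v (t, θ)) (fderiv ℝ v (t, θ) (0, 1)) θ := by
    intro θ
    have h1 := (hv.contDiff.differentiable (by simp) (t, θ)).hasFDerivAt
    exact h1.comp_hasDerivAt θ ((hasDerivAt_const θ t).prodMk (hasDerivAt_id θ))
  have hc' : Continuous fun θ => fderiv ℝ v (t, θ) (0, 1) :=
    (hv.fderiv_apply (0, 1)).contDiff.continuous.comp (by fun_prop)
  have h2 := intervalIntegral.integral_eq_sub_of_hasDerivAt (a := -Real.pi) (b := Real.pi)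
    (fun θ _ => hd θ) (hc'.intervalIntegrable _ _)
  have h3 := hv.periodic t (-Real.pi)
  rw [show -Real.pi + 2 * Real.pi = Real.pi by ring] at h3
  rw [h3, sub_self, intervalIntegral.integral_of_le (by linarith [Real.pi_pos])] at h2
  simp only
  rw [integral_smul_measure, h2, smul_zero]
  rfl

/-- The Fourier transform on the cylinder. -/
noncomputable def cylFourier (v : ℝ × ℝ → ℂ) (k : ℤ × ℝ) : ℂ :=
  ∫ x, v x * cylWave x (-k) ∂cylMeasure

theorem fderiv_cylWave_apply (x : ℝ × ℝ) (k : ℤ × ℝ) (w : ℝ × ℝ) :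
    fderiv ℝ (fun x => cylWave x k) x w =
      Complex.I * ((k.1 * w.2 + 2 * Real.pi * w.1 * k.2 : ℝ) : ℂ) * cylWave x k := by
  have h1 : HasFDerivAt (fun x : ℝ × ℝ => k.1 * x.2 + 2 * Real.pi * x.1 * k.2)
      ((k.1 : ℝ) • ContinuousLinearMap.snd ℝ ℝ ℝ +
        (2 * Real.pi * k.2) • ContinuousLinearMap.fst ℝ ℝ ℝ) x := by
    have := (hasFDerivAt_snd (𝕜 := ℝ) (p := x)).const_mul (k.1 : ℝ)
    have h2 := (hasFDerivAt_fst (𝕜 := ℝ) (p := x)).const_mul (2 * Real.pi * k.2)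
    refine (this.add h2).congr_of_eventuallyEq (.of_forall fun y => ?_)
    change _ = (k.1 : ℝ) * y.2 + 2 * Real.pi * k.2 * y.1
    ring
  have h2 := ((Complex.ofRealCLM.hasFDerivAt.comp x h1).const_mul Complex.I).cexp
  have h3 := h2.fderiv
  simp only [Function.comp_def, Complex.ofRealCLM_apply] at h3
  unfold cylWave
  rw [h3]
  simp
  ring

theorem IsCylTest.cylFourier_fderiv_fst {v : ℝ × ℝ → ℂ} (hv : IsCylTest v) (k : ℤ × ℝ) :
    cylFourier (fun x => fderiv ℝ v x (1, 0)) k =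
      Complex.I * (2 * Real.pi * k.2 : ℝ) * cylFourier v k := by
  have h := (hv.mul_cylWave (-k)).integral_fderiv_fst
  have hw : ∀ x, DifferentiableAt ℝ (fun x => cylWave x (-k)) x := by
    intro x
    unfold cylWave
    fun_prop
  have h1 : ∀ x, fderiv ℝ (fun x => v x * cylWave x (-k)) x (1, 0) =
      fderiv ℝ v x (1, 0) * cylWave x (-k) -
        Complex.I * (2 * Real.pi * k.2 : ℝ) * (v x * cylWave x (-k)) := by
    intro x
    rw [fderiv_fun_mul (hv.contDiff.differentiable (by simp) x) (hw x)]
    simp only [add_apply, smul_apply, fderiv_cylWave_apply,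
      smul_eq_mul, Prod.fst_neg, Prod.snd_neg]
    push_cast
    ring
  simp only [h1] at h
  rw [integral_sub, integral_const_mul, sub_eq_zero] at h
  · exact h
  · exact ((hv.fderiv_apply (1, 0)).mul_cylWave (-k)).integrable
  · exact (hv.mul_cylWave (-k)).integrable.const_mul _

theorem IsCylTest.cylFourier_fderiv_snd {v : ℝ × ℝ → ℂ} (hv : IsCylTest v) (k : ℤ × ℝ) :
    cylFourier (fun x => fderiv ℝ v x (0, 1)) k =
      Complex.I * k.1 * cylFourier v k := by
  have h := (hv.mul_cylWave (-k)).integral_fderiv_snd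
  have hw : ∀ x, DifferentiableAt ℝ (fun x => cylWave x (-k)) x := by
    intro x
    unfold cylWave
    fun_prop
  have h1 : ∀ x, fderiv ℝ (fun x => v x * cylWave x (-k)) x (0, 1) =
      fderiv ℝ v x (0, 1) * cylWave x (-k) -
        Complex.I * k.1 * (v x * cylWave x (-k)) := by
    intro x
    rw [fderiv_fun_mul (hv.contDiff.differentiable (by simp) x) (hw x)]
    simp only [add_apply, smul_apply, fderiv_cylWave_apply,
      smul_eq_mul, Prod.fst_neg, Prod.snd_neg]
    push_cast
    ring
  simp only [h1] at h
  rw [integral_sub, integral_const_mul, sub_eq_zero] at h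
  · exact h
  · exact ((hv.fderiv_apply (0, 1)).mul_cylWave (-k)).integrable
  · exact (hv.mul_cylWave (-k)).integrable.const_mul _

theorem cylFourier_const_mul (v : ℝ × ℝ → ℂ) (c : ℂ) (k : ℤ × ℝ) :
    cylFourier (fun x => c * v x) k = c * cylFourier v k := by
  unfold cylFourier
  simp only [mul_assoc]
  rw [integral_const_mul]

theorem IsCylTest.cylFourier_sub {v w : ℝ × ℝ → ℂ} (hv : IsCylTest v) (hw : IsCylTest w)
    (k : ℤ × ℝ) : cylFourier (fun x => v x - w x) k = cylFourier v k - cylFourier w k := by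
  unfold cylFourier
  simp only [sub_mul]
  rw [integral_sub (hv.mul_cylWave _).integrable (hw.mul_cylWave _).integrable]

theorem norm_cylFourier_le (v : ℝ × ℝ → ℂ) (k : ℤ × ℝ) :
    ‖cylFourier v k‖ ≤ ∫ x, ‖v x‖ ∂cylMeasure := by
  refine (norm_integral_le_integral_norm _).trans_eq ?_
  simp [norm_cylWave]

theorem IsCylTest.measurable_cylFourier {v : ℝ × ℝ → ℂ} (hv : IsCylTest v) :
    Measurable (cylFourier v) := by
  have h1 : Measurable fun q : (ℤ × ℝ) × (ℝ × ℝ) => v q.2 * cylWave q.2 (-q.1) := by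
    have h2 : Measurable fun q : (ℤ × ℝ) × (ℝ × ℝ) => cylWave q.2 (-q.1) := by
      simp only [cylWave, Prod.fst_neg, Prod.snd_neg, Int.cast_neg]
      fun_prop
    have h3 : Measurable fun q : (ℤ × ℝ) × (ℝ × ℝ) => v q.2 :=
      hv.contDiff.continuous.measurable.comp measurable_snd
    exact h3.mul h2
  exact h1.stronglyMeasurable.integral_prod_right'.measurable

/-- The angular part `-i∂_θ - Φ` of the Aharonov–Bohm operator. -/
noncomputable def angDeriv (Φ : ℝ) (v : ℝ × ℝ → ℂ) (x : ℝ × ℝ) : ℂ :=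
  -Complex.I * fderiv ℝ v x (0, 1) - Φ * v x

theorem IsCylTest.angDeriv {v : ℝ × ℝ → ℂ} (hv : IsCylTest v) (Φ : ℝ) :
    IsCylTest (angDeriv Φ v) :=
  ((hv.fderiv_apply (0, 1)).const_mul _).sub (hv.const_mul _)

theorem IsCylTest.cylFourier_angDeriv {v : ℝ × ℝ → ℂ} (hv : IsCylTest v) (Φ : ℝ) (k : ℤ × ℝ) :
    cylFourier (_root_.angDeriv Φ v) k = ((k.1 - Φ : ℝ) : ℂ) * cylFourier v k := by
  have h := ((hv.fderiv_apply (0, 1)).const_mul (-Complex.I)).cylFourier_sub (hv.const_mul Φ) k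
  rw [cylFourier_const_mul, cylFourier_const_mul, hv.cylFourier_fderiv_snd] at h
  refine h.trans ?_
  push_cast
  linear_combination (-(k.1 : ℂ) * cylFourier v k) * Complex.I_sq

theorem IsCylTest.exists_cylFourier_eq {v : ℝ × ℝ → ℂ} (hv : IsCylTest v) (Φ : ℝ) :
    ∃ w, IsCylTest w ∧ ∀ k, cylFourier w k = cylSymbol Φ k * cylFourier v k := by
  have h1 := hv.fderiv_apply (1, 0)
  refine ⟨_, ((hv.angDeriv Φ).angDeriv Φ).sub (h1.fderiv_apply (1, 0)), fun k => ?_⟩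
  rw [((hv.angDeriv Φ).angDeriv Φ).cylFourier_sub (h1.fderiv_apply (1, 0)),
    (hv.angDeriv Φ).cylFourier_angDeriv, hv.cylFourier_angDeriv, h1.cylFourier_fderiv_fst,
    hv.cylFourier_fderiv_fst, cylSymbol]
  push_cast
  linear_combination (-(2 * Real.pi * k.2) ^ 2 * cylFourier v k) * Complex.I_sq

theorem IsCylTest.exists_norm_cylFourier_le {v : ℝ × ℝ → ℂ} (hv : IsCylTest v) {Φ : ℝ}
    (hΦ : ∀ k : ℤ, Φ ≠ k) : ∃ C, 0 ≤ C ∧ ∀ k, ‖cylFourier v k‖ ≤ C * cylSymbol Φ k ^ (-2 : ℝ) := by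
  obtain ⟨w, hw, h1⟩ := hv.exists_cylFourier_eq Φ
  obtain ⟨z, hz, h2⟩ := hw.exists_cylFourier_eq Φ
  obtain ⟨δ, hδ, hm⟩ := exists_pos_le_cylSymbol hΦ
  refine ⟨∫ x, ‖z x‖ ∂cylMeasure, integral_nonneg fun _ => norm_nonneg _, fun k => ?_⟩
  have hpos := hδ.trans_le (hm k)
  have h3 := norm_cylFourier_le z k
  rw [h2, h1, norm_mul, norm_mul, Complex.norm_real, Real.norm_of_nonneg hpos.le] at h3
  rw [Real.rpow_neg hpos.le, ← div_eq_mul_inv, Real.rpow_two, le_div_iff₀ (by positivity)]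
  linarith

theorem integrable_memLp_of_norm_le_cylSymbol_rpow {Φ : ℝ} (hΦ : ∀ k : ℤ, Φ ≠ k)
    {f : ℤ × ℝ → ℂ} (hf : Measurable f) {C q : ℝ} (hq : 1 < q)
    (hfC : ∀ k, ‖f k‖ ≤ C * cylSymbol Φ k ^ (-q)) :
    Integrable f dualMeasure ∧ MemLp f 2 dualMeasure := by
  obtain ⟨δ, hδ, hm⟩ := exists_pos_le_cylSymbol hΦ
  refine ⟨((integrable_cylSymbol_rpow hΦ hq).1.const_mul C).mono' hf.aestronglyMeasurable
    (.of_forall hfC), (memLp_two_iff_integrable_sq_norm hf.aestronglyMeasurable).2 ?_⟩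
  refine ((integrable_cylSymbol_rpow hΦ (show 1 < 2 * q by linarith)).1.const_mul (C ^ 2)).mono'
    (hf.norm.pow_const 2).aestronglyMeasurable (.of_forall fun k => ?_)
  have hpos := hδ.trans_le (hm k)
  rw [Real.norm_of_nonneg (by positivity)]
  refine (pow_le_pow_left₀ (norm_nonneg _) (hfC k) 2).trans_eq ?_
  rw [mul_pow, ← Real.rpow_natCast (cylSymbol Φ k ^ (-q)), ← Real.rpow_mul hpos.le]
  congr 2
  push_cast
  ring

theorem IsCylTest.integrable_cylFourier {v : ℝ × ℝ → ℂ} (hv : IsCylTest v) {Φ : ℝ}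
    (hΦ : ∀ k : ℤ, Φ ≠ k) : Integrable (cylFourier v) dualMeasure ∧
      MemLp (cylFourier v) 2 dualMeasure := by
  obtain ⟨C, -, hC⟩ := hv.exists_norm_cylFourier_le hΦ
  exact integrable_memLp_of_norm_le_cylSymbol_rpow hΦ hv.measurable_cylFourier (by norm_num) hC

theorem IsCylTest.integrable_sqrt_mul_cylFourier {v : ℝ × ℝ → ℂ} (hv : IsCylTest v) {Φ : ℝ}
    (hΦ : ∀ k : ℤ, Φ ≠ k) :
    Integrable (fun k => (√(cylSymbol Φ k) : ℂ) * cylFourier v k) dualMeasure ∧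
      MemLp (fun k => (√(cylSymbol Φ k) : ℂ) * cylFourier v k) 2 dualMeasure := by
  obtain ⟨C, -, hC⟩ := hv.exists_norm_cylFourier_le hΦ
  obtain ⟨δ, hδ, hm⟩ := exists_pos_le_cylSymbol hΦ
  refine integrable_memLp_of_norm_le_cylSymbol_rpow hΦ (C := C) (q := 3 / 2) ?_ (by norm_num)
    fun k => ?_
  · exact (Complex.measurable_ofReal.comp (measurable_cylSymbol Φ).sqrt).mul
      hv.measurable_cylFourier
  · have hpos := hδ.trans_le (hm k)
    rw [norm_mul, Complex.norm_real, Real.norm_of_nonneg (Real.sqrt_nonneg _)]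
    refine (mul_le_mul_of_nonneg_left (hC k) (Real.sqrt_nonneg _)).trans_eq ?_
    rw [Real.sqrt_eq_rpow, mul_left_comm, ← Real.rpow_add hpos]
    norm_num

/-- The angular Fourier coefficients of a function on the cylinder. -/
noncomputable def angCoeff (v : ℝ × ℝ → ℂ) (n : ℤ) (t : ℝ) : ℂ :=
  ∫ θ, v (t, θ) * cylWave (t, θ) (-(n, 0))
    ∂(ENNReal.ofReal (2 * Real.pi)⁻¹ • volume.restrict (Set.Ioc (-Real.pi) Real.pi))

theorem IsCylTest.integrable_angCoeff {v : ℝ × ℝ → ℂ} (hv : IsCylTest v) (n : ℤ) :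
    Integrable (angCoeff v n) := by
  have h := (hv.mul_cylWave (-(n, 0))).integrable
  rw [cylMeasure] at h
  exact h.integral_prod_left

instance isFiniteMeasure_angular : IsFiniteMeasure
    (ENNReal.ofReal (2 * Real.pi)⁻¹ • volume.restrict (Set.Ioc (-Real.pi) Real.pi)) :=
  Measure.smul_finite _ ENNReal.ofReal_ne_top

theorem IsCylTest.continuous_angCoeff {v : ℝ × ℝ → ℂ} (hv : IsCylTest v) (n : ℤ) :
    Continuous (angCoeff v n) := by
  obtain ⟨C, hC⟩ := hv.exists_norm_le
  have hc := (hv.mul_cylWave (-(n, 0))).contDiff.continuous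
  refine continuous_of_dominated (bound := fun _ => C) (fun t => ?_)
    (fun t => .of_forall fun θ => ?_) (integrable_const C) (.of_forall fun θ => ?_)
  · exact (hc.comp (by fun_prop : Continuous fun θ : ℝ => (t, θ))).aestronglyMeasurable
  · rw [norm_mul, norm_cylWave, mul_one]
    exact hC _
  · exact hc.comp (by fun_prop : Continuous fun t : ℝ => (t, θ))

open FourierTransform in
theorem IsCylTest.fourier_angCoeff {v : ℝ × ℝ → ℂ} (hv : IsCylTest v) (n : ℤ) (ξ : ℝ) :
    𝓕 (angCoeff v n) ξ = cylFourier v (n, ξ) := by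
  have h := (hv.mul_cylWave (-(n, ξ))).integrable
  rw [cylMeasure] at h
  rw [Real.fourier_eq', cylFourier, cylMeasure, integral_prod _ h]
  refine integral_congr_ae (.of_forall fun t => ?_)
  simp only [angCoeff, smul_eq_mul]
  rw [← integral_const_mul]
  refine integral_congr_ae (.of_forall fun θ => ?_)
  simp only [cylWave, RCLike.inner_apply, conj_trivial]
  rw [mul_left_comm, ← Complex.exp_add]
  congr 2
  simp only [Prod.fst_neg, Prod.snd_neg]
  push_cast
  ring

theorem IsCylTest.hasSum_angCoeff {v : ℝ × ℝ → ℂ} (hv : IsCylTest v) (t θ : ℝ)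
    (hs : Summable fun n => angCoeff v n t) :
    HasSum (fun n : ℤ => angCoeff v n t * Complex.exp (Complex.I * (n * θ))) (v (t, θ)) := by
  have hT : Fact (0 < 2 * Real.pi) := ⟨Real.two_pi_pos⟩
  have hper : Function.Periodic (fun s => v (t, s)) (2 * Real.pi) := hv.periodic t
  have hc : Continuous fun s => v (t, s) := hv.contDiff.continuous.comp (by fun_prop)
  let g : C(AddCircle (2 * Real.pi), ℂ) := ⟨hper.lift, continuous_coinduced_dom.2 hc⟩
  have hg : ∀ s : ℝ, g (s : AddCircle (2 * Real.pi)) = v (t, s) := fun s => hper.lift_coe s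
  have hpi : (Real.pi : ℂ) ≠ 0 := by exact_mod_cast Real.pi_ne_zero
  have hco : ∀ n, fourierCoeff g n = angCoeff v n t := by
    intro n
    rw [fourierCoeff_eq_intervalIntegral g n (-Real.pi), angCoeff, integral_smul_measure,
      intervalIntegral.integral_of_le (by linarith [Real.pi_pos]), one_div,
      ENNReal.toReal_ofReal (by positivity), show -Real.pi + 2 * Real.pi = Real.pi by ring]
    congr 1
    refine integral_congr_ae (.of_forall fun s => ?_)
    simp only [hg, smul_eq_mul, fourier_coe_apply, cylWave]
    rw [mul_comm]
    congr 2
    simp only [Prod.fst_neg, Prod.snd_neg]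
    push_cast
    field_simp
    ring
  have h := has_pointwise_sum_fourier_series_of_summable (f := g) (hs.congr fun n => (hco n).symm)
    (θ : AddCircle (2 * Real.pi))
  rw [hg] at h
  refine h.congr_fun fun n => ?_
  rw [hco, smul_eq_mul, fourier_coe_apply]
  congr 2
  push_cast
  field_simp

open FourierTransform in
theorem IsCylTest.integral_cylFourier_mul_cylWave {v : ℝ × ℝ → ℂ} (hv : IsCylTest v) {Φ : ℝ}
    (hΦ : ∀ k : ℤ, Φ ≠ k) (x : ℝ × ℝ) :
    ∫ k, cylFourier v k * cylWave x k ∂dualMeasure = v x := by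
  have hi := (hv.integrable_cylFourier hΦ).1
  have h1 : ∀ n t, 𝓕⁻ (fun ξ => cylFourier v (n, ξ)) t = angCoeff v n t := by
    intro n t
    have h2 : (fun ξ => cylFourier v (n, ξ)) = 𝓕 (angCoeff v n) :=
      funext fun ξ => (hv.fourier_angCoeff n ξ).symm
    have h3 := Integrable.dualMeasure_slice hi n
    rw [h2] at h3 ⊢
    rw [(hv.continuous_angCoeff n).fourierInv_fourier_eq (hv.integrable_angCoeff n) h3]
  rw [integral_mul_cylWave hi]
  simp only [h1]
  refine (hv.hasSum_angCoeff x.1 x.2 ?_).tsum_eq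
  refine (Integrable.summable_dualMeasure hi).of_norm_bounded fun n => ?_
  rw [← h1]
  exact VectorFourier.norm_fourierIntegral_le_integral_norm _ _ _ _ _

theorem IsCylTest.integral_norm_sq {v : ℝ × ℝ → ℂ} (hv : IsCylTest v) {Φ : ℝ}
    (hΦ : ∀ k : ℤ, Φ ≠ k) :
    ∫ x, ‖v x‖ ^ 2 ∂cylMeasure = ∫ k, ‖cylFourier v k‖ ^ 2 ∂dualMeasure := by
  have hi := hv.integrable_cylFourier hΦ
  rw [← (memLp_integral_mul_cylWave hi.1 hi.2).2]
  simp only [hv.integral_cylFourier_mul_cylWave hΦ]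

theorem IsCylTest.integral_energy {v : ℝ × ℝ → ℂ} (hv : IsCylTest v) {Φ : ℝ}
    (hΦ : ∀ k : ℤ, Φ ≠ k) :
    ∫ x, (‖fderiv ℝ v x (1, 0)‖ ^ 2 + ‖_root_.angDeriv Φ v x‖ ^ 2) ∂cylMeasure =
      ∫ k, ‖(√(cylSymbol Φ k) : ℂ) * cylFourier v k‖ ^ 2 ∂dualMeasure := by
  have h1 := hv.fderiv_apply (1, 0)
  have h2 := hv.angDeriv Φ
  rw [integral_add h1.integrable_norm_sq h2.integrable_norm_sq, h1.integral_norm_sq hΦ,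
    h2.integral_norm_sq hΦ, ← integral_add]
  · refine integral_congr_ae (.of_forall fun k => ?_)
    simp only [hv.cylFourier_fderiv_fst, hv.cylFourier_angDeriv, norm_mul, Complex.norm_I, one_mul,
      Complex.norm_real, mul_pow, Real.norm_eq_abs, sq_abs]
    rw [Real.sq_sqrt (by unfold cylSymbol; positivity), cylSymbol]
    ring
  · exact ((h1.integrable_cylFourier hΦ).2).integrable_norm_pow (by norm_num)
  · exact ((h2.integrable_cylFourier hΦ).2).integrable_norm_pow (by norm_num)

/-- Logarithmic polar coordinates. -/
noncomputable def logPolar (x : ℝ × ℝ) : ℝ × ℝ :=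
  (Real.exp x.1 * Real.cos x.2, Real.exp x.1 * Real.sin x.2)

/-- The derivative of `logPolar`. -/
noncomputable def logPolarDeriv (x : ℝ × ℝ) : ℝ × ℝ →L[ℝ] ℝ × ℝ :=
  (Matrix.toLin (.finTwoProd ℝ) (.finTwoProd ℝ)
    !![Real.exp x.1 * Real.cos x.2, -(Real.exp x.1 * Real.sin x.2);
      Real.exp x.1 * Real.sin x.2, Real.exp x.1 * Real.cos x.2]).toContinuousLinearMap

theorem logPolarDeriv_apply (x w : ℝ × ℝ) : logPolarDeriv x w =
    (Real.exp x.1 * Real.cos x.2 * w.1 + -(Real.exp x.1 * Real.sin x.2) * w.2,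
      Real.exp x.1 * Real.sin x.2 * w.1 + Real.exp x.1 * Real.cos x.2 * w.2) := by
  rw [logPolarDeriv, Matrix.toLin_finTwoProd_toContinuousLinearMap]
  simp

theorem contDiff_logPolar : ContDiff ℝ (⊤ : ℕ∞) logPolar := by
  unfold logPolar
  exact (contDiff_fst.exp.mul contDiff_snd.cos).prodMk (contDiff_fst.exp.mul contDiff_snd.sin)

theorem hasFDerivAt_logPolar (x : ℝ × ℝ) : HasFDerivAt logPolar (logPolarDeriv x) x := by
  have he : HasFDerivAt (fun p : ℝ × ℝ => Real.exp p.1) _ x :=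
    (hasFDerivAt_fst (𝕜 := ℝ) (p := x)).exp
  have hc : HasFDerivAt (fun p : ℝ × ℝ => Real.cos p.2) _ x :=
    (hasFDerivAt_snd (𝕜 := ℝ) (p := x)).cos
  have hs : HasFDerivAt (fun p : ℝ × ℝ => Real.sin p.2) _ x :=
    (hasFDerivAt_snd (𝕜 := ℝ) (p := x)).sin
  convert! (he.mul hc).prodMk (he.mul hs) using 1
  ext <;> simp [logPolarDeriv_apply] <;> ring

theorem det_logPolarDeriv (x : ℝ × ℝ) : (logPolarDeriv x).det = Real.exp x.1 ^ 2 := by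
  unfold logPolarDeriv
  simp only [LinearMap.det_toContinuousLinearMap, LinearMap.det_toLin, Matrix.det_fin_two_of]
  linear_combination Real.exp x.1 ^ 2 * Real.sin_sq_add_cos_sq x.2

theorem logPolar_eq (x : ℝ × ℝ) : logPolar x = polarCoord.symm (Real.exp x.1, x.2) := rfl

theorem logPolar_image :
    logPolar '' (Set.univ ×ˢ Set.Ioo (-Real.pi) Real.pi) = polarCoord.source := by
  rw [← polarCoord.symm_image_target_eq_source]
  ext y
  constructor
  · rintro ⟨x, hx, rfl⟩
    exact ⟨(Real.exp x.1, x.2), ⟨Real.exp_pos _, hx.2⟩, rfl⟩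
  · rintro ⟨p, hp, rfl⟩
    exact ⟨(Real.log p.1, p.2), ⟨trivial, hp.2⟩, by rw [logPolar_eq, Real.exp_log hp.1]⟩

theorem logPolar_injOn : Set.InjOn logPolar (Set.univ ×ˢ Set.Ioo (-Real.pi) Real.pi) := by
  intro x hx y hy h
  rw [logPolar_eq, logPolar_eq] at h
  have h2 := polarCoord.symm.injOn
    (show (Real.exp x.1, x.2) ∈ polarCoord.target from ⟨Real.exp_pos _, hx.2⟩)
    (show (Real.exp y.1, y.2) ∈ polarCoord.target from ⟨Real.exp_pos _, hy.2⟩) h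
  rw [Prod.mk.injEq, Real.exp_eq_exp] at h2
  exact Prod.ext h2.1 h2.2

theorem exists_logPolar_eq {y : ℝ × ℝ} (hy : y ≠ 0) : ∃ x, logPolar x = y := by
  set z : ℂ := ⟨y.1, y.2⟩ with hz
  have hz0 : z ≠ 0 := fun h => hy (Prod.ext (congrArg Complex.re h) (congrArg Complex.im h))
  refine ⟨(Real.log ‖z‖, z.arg), ?_⟩
  rw [logPolar, Real.exp_log (norm_pos_iff.2 hz0), Complex.norm_mul_cos_arg,
    Complex.norm_mul_sin_arg]

theorem sqnorm_logPolar (x : ℝ × ℝ) : sqnorm (logPolar x) = Real.exp x.1 ^ 2 := by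
  unfold sqnorm logPolar
  linear_combination Real.exp x.1 ^ 2 * Real.sin_sq_add_cos_sq x.2

theorem restrict_univ_prod_Ioc :
    (volume : Measure (ℝ × ℝ)).restrict (Set.univ ×ˢ Set.Ioc (-Real.pi) Real.pi) =
      volume.restrict (Set.univ ×ˢ Set.Ioo (-Real.pi) Real.pi) := by
  rw [Measure.volume_eq_prod, ← Measure.prod_restrict, ← Measure.prod_restrict,
    Measure.restrict_congr_set Ioo_ae_eq_Ioc]

theorem integral_eq_integral_cylMeasure {E : Type*} [NormedAddCommGroup E] [NormedSpace ℝ E]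
    (F : ℝ × ℝ → E) :
    ∫ y, F y = (2 * Real.pi) • ∫ x, Real.exp x.1 ^ 2 • F (logPolar x) ∂cylMeasure := by
  rw [cylMeasure_eq, integral_smul_measure, ENNReal.toReal_ofReal (by positivity), smul_smul,
    mul_inv_cancel₀ (by positivity), one_smul, restrict_univ_prod_Ioc, ← setIntegral_univ,
    setIntegral_congr_set polarCoord_source_ae_eq_univ.symm, ← logPolar_image,
    integral_image_eq_integral_abs_det_fderiv_smul volume
      (MeasurableSet.univ.prod measurableSet_Ioo)
      (fun x _ => (hasFDerivAt_logPolar x).hasFDerivWithinAt) logPolar_injOn]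
  simp_rw [det_logPolarDeriv, abs_of_pos (pow_pos (Real.exp_pos _) 2)]

theorem integrable_iff_integrable_cylMeasure {E : Type*} [NormedAddCommGroup E] [NormedSpace ℝ E]
    (F : ℝ × ℝ → E) :
    Integrable F ↔ Integrable (fun x => Real.exp x.1 ^ 2 • F (logPolar x)) cylMeasure := by
  rw [cylMeasure_eq, integrable_smul_measure (by simp [Real.pi_pos]) ENNReal.ofReal_ne_top,
    restrict_univ_prod_Ioc, ← integrableOn_univ,
    integrableOn_congr_set_ae polarCoord_source_ae_eq_univ.symm, ← logPolar_image,
    integrableOn_image_iff_integrableOn_abs_det_fderiv_smul volume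
      (MeasurableSet.univ.prod measurableSet_Ioo)
      (fun x _ => (hasFDerivAt_logPolar x).hasFDerivWithinAt) logPolar_injOn]
  simp_rw [det_logPolarDeriv, abs_of_pos (pow_pos (Real.exp_pos _) 2)]
  rfl

theorem IsTestFun.isCylTest {u : ℝ × ℝ → ℂ} (hu : IsTestFun u) :
    IsCylTest fun x => u (logPolar x) := by
  obtain ⟨h1, h2, h3⟩ := hu
  refine ⟨h1.comp contDiff_logPolar, fun t θ => ?_, ?_⟩
  · simp [logPolar]
  · obtain ⟨r, hr, h4⟩ := Metric.eventually_nhds_iff_ball.1 h3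
    obtain ⟨ρ, hρ⟩ := h2.isCompact.isBounded.exists_norm_le
    refine ⟨max (-Real.log r) (Real.log (2 * |ρ| + 1)), fun t θ ht => ?_⟩
    rcases lt_or_ge t 0 with h0 | h0
    · rw [abs_of_neg h0] at ht
      have h5 : Real.exp t < r := by
        rw [← Real.lt_log_iff_exp_lt hr]
        linarith [(le_max_left _ _).trans_lt ht]
      apply h4
      rw [mem_ball_zero_iff, logPolar, Prod.norm_mk, max_lt_iff, norm_mul, norm_mul,
        Real.norm_of_nonneg (Real.exp_pos t).le]
      constructor
      · exact (mul_le_of_le_one_right (Real.exp_pos t).le (Real.abs_cos_le_one θ)).trans_lt h5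
      · exact (mul_le_of_le_one_right (Real.exp_pos t).le (Real.abs_sin_le_one θ)).trans_lt h5
    · rw [abs_of_nonneg h0] at ht
      have h5 : 2 * |ρ| + 1 < Real.exp t := by
        rw [← Real.log_lt_iff_lt_exp (by positivity)]
        exact (le_max_right _ _).trans_lt ht
      by_contra hne
      have h6 := (hρ _ (subset_tsupport u hne)).trans (le_abs_self ρ)
      rw [Prod.norm_def, max_le_iff, Real.norm_eq_abs, Real.norm_eq_abs] at h6
      have h7 := sqnorm_logPolar (t, θ)
      unfold sqnorm at h7
      have h8 := pow_le_pow_left₀ (abs_nonneg _) h6.1 2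
      have h9 := pow_le_pow_left₀ (abs_nonneg _) h6.2 2
      rw [sq_abs] at h8 h9
      simp only at h7
      nlinarith [abs_nonneg ρ]

theorem IsTestFun.fderiv_comp_logPolar {u : ℝ × ℝ → ℂ} (hu : IsTestFun u) (x w : ℝ × ℝ) :
    fderiv ℝ (fun x => u (logPolar x)) x w =
      (logPolarDeriv x w).1 * fderiv ℝ u (logPolar x) (1, 0) +
        (logPolarDeriv x w).2 * fderiv ℝ u (logPolar x) (0, 1) := by
  have h1 := (hu.1.differentiable (by simp) (logPolar x)).hasFDerivAt.comp x
    (hasFDerivAt_logPolar x)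
  have h2 : logPolarDeriv x w =
      (logPolarDeriv x w).1 • ((1, 0) : ℝ × ℝ) + (logPolarDeriv x w).2 • ((0, 1) : ℝ × ℝ) := by
    ext <;> simp
  rw [show (fun x => u (logPolar x)) = u ∘ logPolar from rfl, h1.fderiv,
    ContinuousLinearMap.comp_apply]
  conv_lhs => rw [h2]
  rw [map_add, map_smul, map_smul, Complex.real_smul, Complex.real_smul]

theorem norm_sq_add_norm_sq_rotate (p q : ℂ) (θ : ℝ) :
    ‖Real.cos θ * p + Real.sin θ * q‖ ^ 2 + ‖-Real.sin θ * p + Real.cos θ * q‖ ^ 2 =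
      ‖p‖ ^ 2 + ‖q‖ ^ 2 := by
  simp only [Complex.sq_norm, Complex.normSq_apply]
  simp [-Complex.ofReal_cos, -Complex.ofReal_sin]
  linear_combination (p.re ^ 2 + p.im ^ 2 + q.re ^ 2 + q.im ^ 2) * Real.sin_sq_add_cos_sq θ

theorem IsTestFun.magEnergy_eq {u : ℝ × ℝ → ℂ} (hu : IsTestFun u) (Φ : ℝ) :
    magEnergy Φ u = 2 * Real.pi * ∫ x, (‖fderiv ℝ (fun x => u (logPolar x)) x (1, 0)‖ ^ 2 +
      ‖angDeriv Φ (fun x => u (logPolar x)) x‖ ^ 2) ∂cylMeasure := by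
  rw [magEnergy, integral_eq_integral_cylMeasure, smul_eq_mul]
  congr 1
  refine integral_congr_ae (.of_forall fun x => ?_)
  set a := fderiv ℝ u (logPolar x) (1, 0) with ha
  set b := fderiv ℝ u (logPolar x) (0, 1) with hb
  have he := Real.exp_pos x.1
  simp only [angDeriv, hu.fderiv_comp_logPolar, ← ha, ← hb, sqnorm_logPolar, logPolarDeriv_apply,
    smul_eq_mul]
  set E := Real.exp x.1 with hE
  have hEc : (E : ℂ) ≠ 0 := Complex.ofReal_ne_zero.2 he.ne'
  have key := norm_sq_add_norm_sq_rotate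
    (E * (-Complex.I * a + ((Φ * ((logPolar x).2 / E ^ 2) : ℝ) : ℂ) * u (logPolar x)))
    (E * (-Complex.I * b + ((Φ * (-(logPolar x).1 / E ^ 2) : ℝ) : ℂ) * u (logPolar x))) x.2
  have hA : (E : ℂ) * ((Φ * ((logPolar x).2 / E ^ 2) : ℝ) : ℂ) = Φ * Real.sin x.2 := by
    simp only [logPolar, ← hE]
    push_cast
    field_simp
  have hB : (E : ℂ) * ((Φ * (-(logPolar x).1 / E ^ 2) : ℝ) : ℂ) = -Φ * Real.cos x.2 := by
    simp only [logPolar, ← hE]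
    push_cast
    field_simp
  rw [norm_mul (E : ℂ), norm_mul (E : ℂ), mul_pow, mul_pow, Complex.norm_real,
    Real.norm_of_nonneg he.le, ← mul_add] at key
  rw [← key]
  generalize ((Φ * ((logPolar x).2 / E ^ 2) : ℝ) : ℂ) = A at hA ⊢
  generalize ((Φ * (-(logPolar x).1 / E ^ 2) : ℝ) : ℂ) = B at hB ⊢
  have hcs : (Real.sin x.2 : ℂ) ^ 2 + (Real.cos x.2 : ℂ) ^ 2 = 1 := by
    exact_mod_cast Real.sin_sq_add_cos_sq x.2
  congr 2
  · have hn : ∀ z : ℂ, ‖z‖ = ‖Complex.I * z‖ := fun z => by simp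
    rw [hn]
    congr 1
    push_cast [-Complex.ofReal_cos, -Complex.ofReal_sin]
    linear_combination (-Real.cos x.2 * E * a - Real.sin x.2 * E * b) * Complex.I_sq +
      Complex.I * u (logPolar x) * Real.cos x.2 * hA +
      Complex.I * u (logPolar x) * Real.sin x.2 * hB
  · congr 1
    push_cast [-Complex.ofReal_cos, -Complex.ofReal_sin]
    linear_combination -u (logPolar x) * Real.sin x.2 * hA + u (logPolar x) * Real.cos x.2 * hB -
      Φ * u (logPolar x) * hcs

theorem inner_toLp_toLp {X : Type*} [MeasurableSpace X] {μ : Measure X} {f g : X → ℂ}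
    (hf : MemLp f 2 μ) (hg : MemLp g 2 μ) :
    inner ℂ (hf.toLp f) (hg.toLp g) = ∫ x, starRingEnd ℂ (f x) * g x ∂μ := by
  rw [L2.inner_def]
  refine integral_congr_ae ?_
  filter_upwards [hf.coeFn_toLp, hg.coeFn_toLp] with x h1 h2
  rw [h1, h2, RCLike.inner_apply, mul_comm]

/-- The potential transported to the cylinder. -/
noncomputable def cylPotential (V : ℝ × ℝ → ℝ) (x : ℝ × ℝ) : ℝ :=
  Real.exp x.1 ^ 2 * max (V (logPolar x)) 0

theorem cylPotential_nonneg (V : ℝ × ℝ → ℝ) (x : ℝ × ℝ) : 0 ≤ cylPotential V x :=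
  mul_nonneg (by positivity) (le_max_right _ _)

theorem measurable_cylPotential {V : ℝ × ℝ → ℝ} (hV : Measurable V) :
    Measurable (cylPotential V) := by
  have := hV.comp contDiff_logPolar.continuous.measurable
  exact Measurable.mul (by fun_prop) (this.max measurable_const)

theorem cylPotential_rpow (V : ℝ × ℝ → ℝ) (α : ℝ) (x : ℝ × ℝ) :
    cylPotential V x ^ (1 + α / 2) = Real.exp x.1 ^ 2 •
      ((max (V (logPolar x)) 0) ^ (1 + α / 2) * √(sqnorm (logPolar x)) ^ α) := by
  have he := Real.exp_pos x.1
  rw [cylPotential, Real.mul_rpow (by positivity) (le_max_right _ _), sqnorm_logPolar,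
    Real.sqrt_sq he.le, smul_eq_mul, Real.rpow_add (by positivity), Real.rpow_one,
    ← Real.rpow_natCast (Real.exp x.1), ← Real.rpow_mul he.le,
    show ((2 : ℕ) : ℝ) * (α / 2) = α by push_cast; ring]
  ring

theorem integrable_posPart_mul_norm_sq {Φ : ℝ} {V : ℝ × ℝ → ℝ} {M : Submodule ℂ (ℝ × ℝ → ℂ)}
    (hM : IsVNegative Φ V M) {u : ℝ × ℝ → ℂ} (hu : u ∈ M) :
    Integrable (fun x => max (V x) 0 * ‖u x‖ ^ 2) ∧
      magEnergy Φ u ≤ ∫ x, max (V x) 0 * ‖u x‖ ^ 2 := by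
  have h1 : ∀ x, max (V x) 0 * ‖u x‖ ^ 2 = max (V x * ‖u x‖ ^ 2) 0 := fun x => by
    rw [max_mul_of_nonneg _ _ (by positivity), zero_mul]
  rcases eq_or_ne u 0 with rfl | h0
  · simp [magEnergy]
  have h2 := hM.2 u hu h0
  have h3 : 0 ≤ magEnergy Φ u := integral_nonneg fun x => by positivity
  have h4 : Integrable fun x => V x * ‖u x‖ ^ 2 :=
    Integrable.of_integral_ne_zero (h3.trans_lt h2).ne'
  simp only [h1]
  exact ⟨h4.pos_part, h2.le.trans (integral_mono h4 h4.pos_part fun x => le_max_left _ _)⟩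

theorem memLp_sqrt_cylPotential_mul {Φ : ℝ} {V : ℝ × ℝ → ℝ} (hV : Measurable V)
    {M : Submodule ℂ (ℝ × ℝ → ℂ)} (hM : IsVNegative Φ V M) {u : ℝ × ℝ → ℂ} (hu : u ∈ M) :
    MemLp (fun x => (√(cylPotential V x) : ℂ) * u (logPolar x)) 2 cylMeasure := by
  have hc := (hM.1 u hu).isCylTest.contDiff.continuous.measurable
  have hm : Measurable fun x => (√(cylPotential V x) : ℂ) * u (logPolar x) :=
    (Complex.measurable_ofReal.comp (measurable_cylPotential hV).sqrt).mul hc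
  refine (memLp_two_iff_integrable_sq_norm hm.aestronglyMeasurable).2 ?_
  refine ((integrable_iff_integrable_cylMeasure _).1
    (integrable_posPart_mul_norm_sq hM hu).1).congr (.of_forall fun x => ?_)
  simp only [smul_eq_mul, norm_mul, Complex.norm_real, mul_pow, Real.norm_eq_abs, sq_abs]
  rw [Real.sq_sqrt (cylPotential_nonneg V x), cylPotential, mul_assoc]

theorem energy_le_integral_cylPotential {Φ : ℝ} (hΦ : ∀ k : ℤ, Φ ≠ k) {V : ℝ × ℝ → ℝ}
    {M : Submodule ℂ (ℝ × ℝ → ℂ)} (hM : IsVNegative Φ V M) {u : ℝ × ℝ → ℂ} (hu : u ∈ M) :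
    ∫ k, ‖(√(cylSymbol Φ k) : ℂ) * cylFourier (fun x => u (logPolar x)) k‖ ^ 2 ∂dualMeasure ≤
      ∫ x, cylPotential V x * ‖u (logPolar x)‖ ^ 2 ∂cylMeasure := by
  have h1 := (integrable_posPart_mul_norm_sq hM hu).2
  rw [(hM.1 u hu).magEnergy_eq, integral_eq_integral_cylMeasure, smul_eq_mul,
    (hM.1 u hu).isCylTest.integral_energy hΦ] at h1
  refine (le_of_mul_le_mul_left h1 Real.two_pi_pos).trans_eq ?_
  simp only [smul_eq_mul, cylPotential, mul_assoc]

section LinearMaps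

variable {Φ : ℝ} {V : ℝ × ℝ → ℝ} {M : Submodule ℂ (ℝ × ℝ → ℂ)}

/-- The square root of the energy form, as a linear map into `L²` of the dual group. -/
noncomputable def energyMap (hΦ : ∀ k : ℤ, Φ ≠ k) (hM : IsVNegative Φ V M) :
    M →ₗ[ℂ] Lp ℂ 2 dualMeasure where
  toFun u := ((hM.1 u u.2).isCylTest.integrable_sqrt_mul_cylFourier hΦ).2.toLp _
  map_add' u w := by
    rw [← MemLp.toLp_add]
    refine MemLp.toLp_congr _ _ (.of_forall fun k => ?_)
    simp only [cylFourier, Submodule.coe_add, Pi.add_apply, add_mul]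
    rw [integral_add ((hM.1 u u.2).isCylTest.mul_cylWave _).integrable
      ((hM.1 w w.2).isCylTest.mul_cylWave _).integrable, mul_add]
  map_smul' c u := by
    rw [RingHom.id_apply, ← MemLp.toLp_const_smul]
    refine MemLp.toLp_congr _ _ (.of_forall fun k => ?_)
    simp only [Submodule.coe_smul, Pi.smul_apply, smul_eq_mul, cylFourier_const_mul]
    ring

/-- Multiplication by the square root of the transported potential, as a linear map. -/
noncomputable def potentialMap (hV : Measurable V) (hM : IsVNegative Φ V M) :
    M →ₗ[ℂ] Lp ℂ 2 cylMeasure where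
  toFun u := (memLp_sqrt_cylPotential_mul hV hM u.2).toLp _
  map_add' u w := by
    rw [← MemLp.toLp_add]
    refine MemLp.toLp_congr _ _ (.of_forall fun k => ?_)
    simp [mul_add]
  map_smul' c u := by
    rw [RingHom.id_apply, ← MemLp.toLp_const_smul]
    refine MemLp.toLp_congr _ _ (.of_forall fun k => ?_)
    simp only [Submodule.coe_smul, Pi.smul_apply, smul_eq_mul]
    ring

theorem energyMap_injective (hΦ : ∀ k : ℤ, Φ ≠ k) (hM : IsVNegative Φ V M) :
    Function.Injective (energyMap hΦ hM) := by
  rw [injective_iff_map_eq_zero]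
  intro u hu
  have hc := (hM.1 u u.2).isCylTest
  have h1 := (hc.integrable_sqrt_mul_cylFourier hΦ).2.coeFn_toLp
  rw [show (hc.integrable_sqrt_mul_cylFourier hΦ).2.toLp _ = 0 from hu] at h1
  obtain ⟨δ, hδ, hm⟩ := exists_pos_le_cylSymbol hΦ
  have h2 : ∀ᵐ k ∂dualMeasure, cylFourier (fun x => (u : ℝ × ℝ → ℂ) (logPolar x)) k = 0 := by
    filter_upwards [h1, Lp.coeFn_zero ℂ 2 dualMeasure] with k hk hk2
    rw [hk2] at hk
    refine (mul_eq_zero.1 hk.symm).resolve_left ?_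
    exact Complex.ofReal_ne_zero.2 (Real.sqrt_pos.2 (hδ.trans_le (hm k))).ne'
  have h3 : ∀ x, (u : ℝ × ℝ → ℂ) (logPolar x) = 0 := by
    intro x
    rw [← hc.integral_cylFourier_mul_cylWave hΦ x]
    refine integral_eq_zero_of_ae ?_
    filter_upwards [h2] with k hk
    rw [hk, zero_mul, Pi.zero_apply]
  ext y
  rcases eq_or_ne y 0 with rfl | hy
  · exact (hM.1 u u.2).2.2.self_of_nhds
  · obtain ⟨x, rfl⟩ := exists_logPolar_eq hy
    exact h3 x

end LinearMaps

theorem weighted_CLR_AharonovBohm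
    (Φ : ℝ) (hΦ : ∀ k : ℤ, Φ ≠ k) (α : ℝ) (hα : 0 < α)
    (V : ℝ × ℝ → ℝ) (hV : Measurable V)
    (hInt : Integrable
      (fun x : ℝ × ℝ => (max (V x) 0) ^ (1 + α / 2) * Real.sqrt (sqnorm x) ^ α))
    (M : Submodule ℂ (ℝ × ℝ → ℂ)) (hfin : FiniteDimensional ℂ M)
    (hM : IsVNegative Φ V M) :
    (Module.finrank ℂ M : ℝ) ≤
      Real.Gamma ((1 + α) / 2) / (4 * Real.pi ^ ((3 : ℝ) / 2) * Real.Gamma (1 + α / 2)) *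
        (∑' n : ℤ, |(n : ℝ) - Φ| ^ (-(1 + α))) *
        ∫ x : ℝ × ℝ, (max (V x) 0) ^ (1 + α / 2) * Real.sqrt (sqnorm x) ^ α := by
  have hp : 1 < 1 + α / 2 := by linarith
  obtain ⟨δ, hδ, hm⟩ := exists_pos_le_cylSymbol hΦ
  obtain ⟨u, hu1, hu2⟩ := exists_orthonormal_orthogonal (energyMap hΦ hM)
    (energyMap_injective hΦ hM) (potentialMap hV hM)
  have hc := fun i => (hM.1 (u i) (u i).2).isCylTest
  choose C hC using fun i => (hc i).exists_norm_le
  have hmp := integrable_cylSymbol_rpow hΦ hp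
  have hW : ∫ x, cylPotential V x ^ (1 + α / 2) ∂cylMeasure = (2 * Real.pi)⁻¹ *
      ∫ x : ℝ × ℝ, (max (V x) 0) ^ (1 + α / 2) * Real.sqrt (sqnorm x) ^ α := by
    rw [integral_eq_integral_cylMeasure, smul_eq_mul, inv_mul_cancel_left₀ (by positivity)]
    simp only [cylPotential_rpow]
  have hon : ∀ i j, ∫ k, starRingEnd ℂ ((√(cylSymbol Φ k) : ℂ) *
      cylFourier (fun x => (u i : ℝ × ℝ → ℂ) (logPolar x)) k) * ((√(cylSymbol Φ k) : ℂ) *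
      cylFourier (fun x => (u j : ℝ × ℝ → ℂ) (logPolar x)) k) ∂dualMeasure =
      if i = j then 1 else 0 := by
    intro i j
    rw [← orthonormal_iff_ite.1 hu1 i j]
    exact (inner_toLp_toLp ((hc i).integrable_sqrt_mul_cylFourier hΦ).2
      ((hc j).integrable_sqrt_mul_cylFourier hΦ).2).symm
  have main := card_le_integral_rpow_mul_integral_rpow (μ := cylMeasure) (ν := dualMeasure) hp
    (e := cylWave) measurable_cylWave (fun x k => (norm_cylWave x k).le)
    (fun h h1 h2 => ⟨(memLp_integral_mul_cylWave h1 h2).1, (memLp_integral_mul_cylWave h1 h2).2.le⟩)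
    (measurable_cylSymbol Φ) hδ hm hmp.1 (measurable_cylPotential hV) (cylPotential_nonneg V)
    (by simpa only [cylPotential_rpow] using (integrable_iff_integrable_cylMeasure _).1 hInt)
    (u := fun i x => (u i : ℝ × ℝ → ℂ) (logPolar x)) (C := ∑ i, |C i|)
    (fun i x => ((hC i x).trans (le_abs_self _)).trans
      (Finset.single_le_sum (f := fun i => |C i|) (fun _ _ => abs_nonneg _) (Finset.mem_univ i)))
    (fun i => (hc i).integrable)
    (f := fun i k => (√(cylSymbol Φ k) : ℂ) *
      cylFourier (fun x => (u i : ℝ × ℝ → ℂ) (logPolar x)) k)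
    (fun i => ((hc i).integrable_sqrt_mul_cylFourier hΦ).1)
    (fun i => ((hc i).integrable_sqrt_mul_cylFourier hΦ).2)
    hon ?_ ?_ ?_
  · rw [hmp.2, hW] at main
    refine main.trans_eq ?_
    rw [show 1 + α / 2 - 1 / 2 = (1 + α) / 2 by ring, show 1 - 2 * (1 + α / 2) = -(1 + α) by ring,
      show (3 : ℝ) / 2 = 1 + 1 / 2 by norm_num, Real.rpow_add Real.pi_pos, Real.rpow_one,
      ← Real.sqrt_eq_rpow]
    have := Real.Gamma_pos_of_pos (show 0 < 1 + α / 2 by linarith)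
    field_simp
    norm_num
    ring
  · intro i
    refine .of_forall fun x => ?_
    rw [← (hc i).integral_cylFourier_mul_cylWave hΦ x]
    refine integral_congr_ae (.of_forall fun k => ?_)
    have hs : (√(cylSymbol Φ k) : ℂ) ≠ 0 :=
      Complex.ofReal_ne_zero.2 (Real.sqrt_pos.2 (hδ.trans_le (hm k))).ne'
    dsimp only
    rw [Complex.ofReal_inv, inv_mul_cancel_left₀ hs]
  · intro i j hij
    have h1 : inner ℂ (potentialMap hV hM (u i)) (potentialMap hV hM (u j)) = 0 := hu2 hij
    rw [show inner ℂ (potentialMap hV hM (u i)) (potentialMap hV hM (u j)) = _ from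
      inner_toLp_toLp (memLp_sqrt_cylPotential_mul hV hM (u i).2)
        (memLp_sqrt_cylPotential_mul hV hM (u j).2)] at h1
    rw [← h1]
    refine integral_congr_ae (.of_forall fun x => ?_)
    have hs : (√(cylPotential V x) : ℂ) * √(cylPotential V x) = cylPotential V x := by
      rw [← Complex.ofReal_mul, Real.mul_self_sqrt (cylPotential_nonneg V x)]
    simp only [map_mul, Complex.conj_ofReal, ← hs]
    ring
  · intro i
    refine le_trans (le_of_eq ?_) (energy_le_integral_cylPotential hΦ hM (u i).2)
    have h1 := hon i i
    rw [if_pos rfl] at h1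
    rw [← Complex.ofReal_inj, ← integral_complex_ofReal, Complex.ofReal_one, ← h1]
    refine integral_congr_ae (.of_forall fun k => ?_)
    dsimp only
    rw [Complex.conj_mul', Complex.ofReal_pow]
end

section
/- For every α > 0 there is a constant c_α > 0 such that the following holds for every Φ ∈ ℝ \ ℤ: if C ≥ 0 is such that for every measurable V : ℝ² → ℝ with ∫_{ℝ²} V(x)_+^{1+α/2}|x|^α dx < ∞, every finite-dimensional complex subspace M of C_c^∞(ℝ²\{0}; ℂ) that is V-negative for D_Φ satisfies dim M ≤ C ∫_{ℝ²} V(x)_+^{1+α/2}|x|^α dx, then C ≥ c_α · d(Φ)^{−1−α}, where d(Φ) = dist(Φ, ℤ). (Lower bound on the optimal constant in the weighted CLR inequality, showing the divergence as the flux approaches an integer.) -/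
open MeasureTheory

/-- The distance `d(Φ) = min_{k ∈ ℤ} |Φ - k|` of a real number to the integers. -/
noncomputable def distToInt (Φ : ℝ) : ℝ := |Φ - round Φ|

lemma sqnorm_pos {x : ℝ × ℝ} (hx : x ≠ 0) : 0 < sqnorm x := by
  have : x.1 ≠ 0 ∨ x.2 ≠ 0 := by
    by_contra! h
    exact hx (Prod.ext h.1 h.2)
  unfold sqnorm
  rcases this with h | h <;> positivity

lemma sqnorm_nonneg (x : ℝ × ℝ) : 0 ≤ sqnorm x := by
  unfold sqnorm; positivity

lemma continuous_sqnorm : Continuous sqnorm := by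
  unfold sqnorm; fun_prop

lemma norm_sq_complex_add (x : ℝ × ℝ) : ‖(x.1 + x.2 * Complex.I : ℂ)‖ ^ 2 = sqnorm x := by
  rw [Complex.sq_norm, Complex.normSq_add_mul_I, sqnorm]

lemma norm_sq_zpow_complex_add (k : ℤ) (x : ℝ × ℝ) :
    ‖(x.1 + x.2 * Complex.I : ℂ) ^ k‖ ^ 2 = sqnorm x ^ k := by
  rw [norm_zpow, ← norm_sq_complex_add, ← zpow_natCast, ← zpow_natCast, zpow_comm]

lemma complex_add_ne_zero {x : ℝ × ℝ} (hx : x ≠ 0) : (x.1 + x.2 * Complex.I : ℂ) ≠ 0 := by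
  intro h
  have := norm_sq_complex_add x
  rw [h] at this
  simp [(sqnorm_pos hx).ne] at this

/-- Integral of a function of `log |x|²` against the scale-invariant measure `|x|⁻² dx`. -/
lemma integral_comp_log_sqnorm (G : ℝ → ℝ) {d : ℝ} (hd : 0 < d) :
    ∫ x : ℝ × ℝ, G (d * Real.log (sqnorm x)) / sqnorm x = Real.pi / d * ∫ t, G t := by
  have hexp : ∫ r in Set.Ioi (0 : ℝ), G (d * Real.log (r ^ 2)) / r
      = ∫ t : ℝ, G (2 * d * t) := by
    have h := integral_image_eq_integral_abs_deriv_smul (s := Set.univ) (f := Real.exp)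
      (f' := Real.exp) MeasurableSet.univ
      (fun x _ => (Real.hasDerivAt_exp x).hasDerivWithinAt) (Real.exp_injective.injOn)
      (fun r => G (d * Real.log (r ^ 2)) / r)
    rw [Set.image_univ, Real.range_exp] at h
    rw [h, setIntegral_univ]
    congr 1; ext t
    rw [abs_of_pos (Real.exp_pos t), Real.log_pow, Real.log_exp, smul_eq_mul,
      mul_div_cancel₀ _ (Real.exp_pos t).ne']
    congr 1; push_cast; ring
  rw [← integral_comp_polarCoord_symm]
  have hpolar : ∀ p ∈ polarCoord.target,
      p.1 • (G (d * Real.log (sqnorm (polarCoord.symm p))) / sqnorm (polarCoord.symm p))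
      = (G (d * Real.log (p.1 ^ 2)) / p.1) * (fun _ : ℝ => (1 : ℝ)) p.2 := by
    intro p hp
    have hp1 : 0 < p.1 := hp.1
    have : sqnorm (polarCoord.symm p) = p.1 ^ 2 := by
      rw [polarCoord_symm_apply, sqnorm]
      linear_combination p.1 ^ 2 * Real.sin_sq_add_cos_sq p.2
    rw [this, smul_eq_mul]
    field_simp
  rw [setIntegral_congr_fun polarCoord.open_target.measurableSet hpolar]
  rw [polarCoord_target, Measure.volume_eq_prod,
    setIntegral_prod_mul (fun r => G (d * Real.log (r ^ 2)) / r) (fun _ : ℝ => (1 : ℝ)), hexp,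
    Measure.integral_comp_mul_left, abs_of_pos (by positivity)]
  simp [Real.pi_pos.le]
  field_simp
  ring

/-- The function `z ^ k ψ(log |z|²)`, of angular momentum `k`. -/
noncomputable def angularFun (k : ℤ) (ψ : ℝ → ℝ) (x : ℝ × ℝ) : ℂ :=
  (x.1 + x.2 * Complex.I : ℂ) ^ k * (ψ (Real.log (sqnorm x)) : ℂ)

/-- The integrand of `magEnergy`. -/
noncomputable def magDensity (Φ : ℝ) (u : ℝ × ℝ → ℂ) (x : ℝ × ℝ) : ℝ :=
  ‖-Complex.I * fderiv ℝ u x (1, 0) + ((Φ * (x.2 / sqnorm x) : ℝ) : ℂ) * u x‖ ^ 2 +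
    ‖-Complex.I * fderiv ℝ u x (0, 1) + ((Φ * (-x.1 / sqnorm x) : ℝ) : ℂ) * u x‖ ^ 2

lemma magDensity_const_smul (Φ : ℝ) {u : ℝ × ℝ → ℂ} {x : ℝ × ℝ} (hu : DifferentiableAt ℝ u x)
    (c : ℂ) : magDensity Φ (c • u) x = ‖c‖ ^ 2 * magDensity Φ u x := by
  have h : ∀ v, fderiv ℝ (c • u) x v = c * fderiv ℝ u x v := by
    intro v
    rw [fderiv_const_smul hu]; rfl
  have h' : ∀ (w : ℝ × ℝ) (b : ℂ), ‖-Complex.I * (c * fderiv ℝ u x w) + b * (c • u) x‖ ^ 2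
      = ‖c‖ ^ 2 * ‖-Complex.I * fderiv ℝ u x w + b * u x‖ ^ 2 := by
    intro w b
    rw [← mul_pow, ← norm_mul]
    congr 2
    simp only [Pi.smul_apply, smul_eq_mul]; ring
  simp only [magDensity, h, h']
  ring

lemma fderiv_angularFun (k : ℤ) {ψ : ℝ → ℝ} (hψ : Differentiable ℝ ψ) {x : ℝ × ℝ} (hx : x ≠ 0)
    (v : ℝ × ℝ) :
    fderiv ℝ (angularFun k ψ) x v
      = (x.1 + x.2 * Complex.I : ℂ) ^ k *
        (k * ((v.1 + v.2 * Complex.I) * (x.1 - x.2 * Complex.I)) * ψ (Real.log (sqnorm x))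
          + 2 * (x.1 * v.1 + x.2 * v.2) * deriv ψ (Real.log (sqnorm x))) / sqnorm x := by
  have hs := sqnorm_pos hx
  have hz := complex_add_ne_zero hx
  have h1 : HasFDerivAt (fun x : ℝ × ℝ => x.1) (ContinuousLinearMap.fst ℝ ℝ ℝ) x := hasFDerivAt_fst
  have h2 : HasFDerivAt (fun x : ℝ × ℝ => x.2) (ContinuousLinearMap.snd ℝ ℝ ℝ) x := hasFDerivAt_snd
  have hZ := (hasDerivAt_zpow k _ (Or.inl hz)).comp_hasFDerivAt x
    (Complex.equivRealProdCLM.symm.hasFDerivAt (x := x) |>.congr_of_eventuallyEq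
      (f₁ := fun x : ℝ × ℝ => (x.1 + x.2 * Complex.I : ℂ))
      (Filter.Eventually.of_forall fun y => by simp [Complex.equivRealProdCLM_symm_apply]))
  have hs' : HasFDerivAt sqnorm _ x := (h1.pow 2).add (h2.pow 2)
  have hR := ((hψ (Real.log (sqnorm x))).hasDerivAt.comp_hasFDerivAt x (hs'.log hs.ne'))
  have hRc := (Complex.ofRealCLM.hasFDerivAt).comp x hR
  have h := hZ.mul hRc
  have heq : angularFun k ψ = ((fun z : ℂ => z ^ k) ∘ fun x : ℝ × ℝ => (x.1 + x.2 * Complex.I : ℂ))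
      * (Complex.ofRealCLM ∘ (ψ ∘ fun x => Real.log (sqnorm x))) := rfl
  rw [heq, h.fderiv]
  have hsz : (sqnorm x : ℂ) = (x.1 + x.2 * Complex.I) * (x.1 - x.2 * Complex.I) := by
    rw [sqnorm]; push_cast; linear_combination (x.2 : ℂ) ^ 2 * Complex.I_sq
  have hs0 : (sqnorm x : ℂ) ≠ 0 := by exact_mod_cast hs.ne'
  simp [Complex.equivRealProdCLM_symm_apply, zpow_sub_one₀ hz]
  field_simp
  linear_combination (ψ (Real.log (sqnorm x)) * k * (v.1 + Complex.I * v.2) : ℂ) * hsz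

lemma magDensity_angularFun (Φ : ℝ) (k : ℤ) {ψ : ℝ → ℝ} (hψ : Differentiable ℝ ψ) {x : ℝ × ℝ}
    (hx : x ≠ 0) :
    magDensity Φ (angularFun k ψ) x
      = sqnorm x ^ k * ((k * ψ (Real.log (sqnorm x)) + 2 * deriv ψ (Real.log (sqnorm x))) ^ 2
        + (Φ - k) ^ 2 * ψ (Real.log (sqnorm x)) ^ 2) / sqnorm x := by
  have hs := sqnorm_pos hx
  have hs0 : (sqnorm x : ℂ) ≠ 0 := by exact_mod_cast hs.ne'
  have hzk := norm_sq_zpow_complex_add k x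
  rw [magDensity, fderiv_angularFun k hψ hx, fderiv_angularFun k hψ hx, angularFun]
  set a := ψ (Real.log (sqnorm x))
  set b := deriv ψ (Real.log (sqnorm x))
  set w := (x.1 + x.2 * Complex.I : ℂ) ^ k
  have e1 : -Complex.I * (w * (k * ((((1 : ℝ) : ℂ) + ((0 : ℝ) : ℂ) * Complex.I)
        * (x.1 - x.2 * Complex.I)) * a
        + 2 * (x.1 * ((1 : ℝ) : ℂ) + x.2 * ((0 : ℝ) : ℂ)) * b) / sqnorm x)
        + ((Φ * (x.2 / sqnorm x) : ℝ) : ℂ) * (w * a)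
      = w * ((((Φ - k) * x.2 * a / sqnorm x : ℝ) : ℂ)
        + ((-(x.1 * (k * a + 2 * b)) / sqnorm x : ℝ) : ℂ) * Complex.I) := by
    push_cast
    field_simp
    linear_combination (w * k * x.2 * a : ℂ) * Complex.I_sq
  have e2 : -Complex.I * (w * (k * ((((0 : ℝ) : ℂ) + ((1 : ℝ) : ℂ) * Complex.I)
        * (x.1 - x.2 * Complex.I)) * a
        + 2 * (x.1 * ((0 : ℝ) : ℂ) + x.2 * ((1 : ℝ) : ℂ)) * b) / sqnorm x)
        + ((Φ * (-x.1 / sqnorm x) : ℝ) : ℂ) * (w * a)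
      = w * (((-((Φ - k) * x.1 * a) / sqnorm x : ℝ) : ℂ)
        + ((-(x.2 * (k * a + 2 * b)) / sqnorm x : ℝ) : ℂ) * Complex.I) := by
    push_cast
    field_simp
    linear_combination w * (-(k * x.1 * a) + k * x.2 * a * Complex.I : ℂ) * Complex.I_sq
  rw [e1, e2, norm_mul, norm_mul, mul_pow, mul_pow, hzk, Complex.sq_norm, Complex.sq_norm,
    Complex.normSq_add_mul_I, Complex.normSq_add_mul_I, ← mul_add,
    mul_div_assoc (sqnorm x ^ k)]
  congr 1
  have : sqnorm x = x.1 ^ 2 + x.2 ^ 2 := rfl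
  field_simp
  rw [this]
  ring

/-- The test function of angular momentum `k` with radial profile `φ(d log |x|²)`. -/
noncomputable def modeFun (k : ℤ) (d : ℝ) (φ : ℝ → ℝ) : ℝ × ℝ → ℂ :=
  angularFun k fun t => φ (d * t) * Real.exp (-(k / 2 * t))

lemma sqnorm_zpow_mul_exp {x : ℝ × ℝ} (hx : x ≠ 0) (k : ℤ) :
    sqnorm x ^ k * Real.exp (-(k / 2 * Real.log (sqnorm x))) ^ 2 = 1 := by
  rw [← Real.rpow_intCast, Real.rpow_def_of_pos (sqnorm_pos hx), ← Real.exp_nat_mul,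
    ← Real.exp_add, Real.exp_eq_one_iff]
  push_cast; ring

lemma norm_sq_modeFun (k : ℤ) (d : ℝ) (φ : ℝ → ℝ) {x : ℝ × ℝ} (hx : x ≠ 0) :
    ‖modeFun k d φ x‖ ^ 2 = φ (d * Real.log (sqnorm x)) ^ 2 := by
  have hzk := norm_sq_zpow_complex_add k x
  rw [modeFun, angularFun, norm_mul, mul_pow, hzk, Complex.norm_real, Real.norm_eq_abs, sq_abs]
  linear_combination φ (d * Real.log (sqnorm x)) ^ 2 * sqnorm_zpow_mul_exp hx k

lemma magDensity_modeFun (Φ : ℝ) (k : ℤ) (d : ℝ) {φ : ℝ → ℝ} (hφ : Differentiable ℝ φ)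
    {x : ℝ × ℝ} (hx : x ≠ 0) :
    magDensity Φ (modeFun k d φ) x
      = (4 * d ^ 2 * deriv φ (d * Real.log (sqnorm x)) ^ 2
        + (Φ - k) ^ 2 * φ (d * Real.log (sqnorm x)) ^ 2) / sqnorm x := by
  have hder : ∀ t, HasDerivAt (fun t => φ (d * t) * Real.exp (-(k / 2 * t)))
      ((deriv φ (d * t) * d) * Real.exp (-(k / 2 * t))
        + φ (d * t) * (Real.exp (-(k / 2 * t)) * -(k / 2))) t := by
    intro t
    have h1 : HasDerivAt (fun t => d * t) d t := by simpa using (hasDerivAt_id t).const_mul d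
    have h2 : HasDerivAt (fun t : ℝ => -(k / 2 * t)) (-(k / 2 : ℝ)) t := by
      simpa using! ((hasDerivAt_id t).const_mul (k / 2 : ℝ)).neg
    exact ((hφ (d * t)).hasDerivAt.comp t h1).mul h2.exp
  rw [modeFun, magDensity_angularFun Φ k (fun t => (hder t).differentiableAt) hx, (hder _).deriv]
  congr 1
  linear_combination (4 * d ^ 2 * deriv φ (d * Real.log (sqnorm x)) ^ 2
        + (Φ - k) ^ 2 * φ (d * Real.log (sqnorm x)) ^ 2) * sqnorm_zpow_mul_exp hx k

section Mode

variable {φ : ℝ → ℝ} {d : ℝ} {k : ℤ}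

lemma modeFun_eq_zero_of_sqnorm_lt (hφ : ∀ t, φ t ≠ 0 → t ∈ Set.Ioo 1 3) (hd : 0 < d)
    {x : ℝ × ℝ} (hx : sqnorm x < 1) : modeFun k d φ x = 0 := by
  have : φ (d * Real.log (sqnorm x)) = 0 := by
    by_contra h
    have h1 := (hφ _ h).1
    have := mul_nonpos_of_nonneg_of_nonpos hd.le (Real.log_nonpos (sqnorm_nonneg x) hx.le)
    linarith
  simp [modeFun, angularFun, this]

lemma modeFun_eventually_eq_zero (hφ : ∀ t, φ t ≠ 0 → t ∈ Set.Ioo 1 3) (hd : 0 < d) :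
    ∀ᶠ x in nhds (0 : ℝ × ℝ), modeFun k d φ x = 0 := by
  have : ∀ᶠ x in nhds (0 : ℝ × ℝ), sqnorm x < 1 :=
    continuous_sqnorm.continuousAt.eventually_lt_const (by simp [sqnorm])
  filter_upwards [this] with x hx using modeFun_eq_zero_of_sqnorm_lt hφ hd hx

lemma isTestFun_modeFun (hφc : ContDiff ℝ (⊤ : ℕ∞) φ)
    (hφ : ∀ t, φ t ≠ 0 → t ∈ Set.Ioo 1 3) (hd : 0 < d) : IsTestFun (modeFun k d φ) := by
  refine ⟨contDiff_iff_contDiffAt.2 fun x => ?_, ?_, modeFun_eventually_eq_zero hφ hd⟩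
  · rcases eq_or_ne x 0 with rfl | hx
    · exact (contDiffAt_const (c := 0)).congr_of_eventuallyEq (modeFun_eventually_eq_zero hφ hd)
    · have hz := complex_add_ne_zero hx
      have hs := (sqnorm_pos hx).ne'
      have hZ : ContDiffAt ℝ (⊤ : ℕ∞) (fun x : ℝ × ℝ => (x.1 + x.2 * Complex.I : ℂ)) x :=
        (((Complex.ofRealCLM.contDiff.comp contDiff_fst).add
          ((Complex.ofRealCLM.contDiff.comp contDiff_snd).mul contDiff_const))).contDiffAt
      have hpow : ContDiffAt ℝ (⊤ : ℕ∞) (fun z : ℂ => z ^ k) (x.1 + x.2 * Complex.I : ℂ) :=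
        ((analyticAt_id.zpow hz).contDiffAt (n := (⊤ : ℕ∞)) (𝕜 := ℂ)).restrict_scalars ℝ
      have hsq : ContDiff ℝ (⊤ : ℕ∞) sqnorm := by unfold sqnorm; fun_prop
      have hlog : ContDiffAt ℝ (⊤ : ℕ∞) (fun x => Real.log (sqnorm x)) x :=
        hsq.contDiffAt.log hs
      have hrad : ContDiff ℝ (⊤ : ℕ∞) fun t => φ (d * t) * Real.exp (-(k / 2 * t)) := by fun_prop
      exact (hpow.comp x hZ).mul
        ((Complex.ofRealCLM.contDiff.contDiffAt.comp x (hrad.contDiffAt.comp x hlog)))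
  · set R := 1 + Real.exp (3 / d)
    refine HasCompactSupport.intro
      ((isCompact_Icc (a := -R) (b := R)).prod (isCompact_Icc (a := -R) (b := R))) fun x hx => ?_
    by_contra hne
    apply hx
    have hφx : φ (d * Real.log (sqnorm x)) ≠ 0 := by
      intro h; apply hne; simp [modeFun, angularFun, h]
    have hlt := (hφ _ hφx).2
    have hs1 : 1 ≤ sqnorm x := by
      by_contra! h
      exact hne (modeFun_eq_zero_of_sqnorm_lt hφ hd h)
    have hlog : Real.log (sqnorm x) < 3 / d := by rw [lt_div_iff₀ hd]; linarith
    have hsE := (Real.log_lt_iff_lt_exp (by linarith)).1 hlog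
    have hE := Real.exp_pos (3 / d)
    have hsR : x.1 ^ 2 + x.2 ^ 2 ≤ R ^ 2 := by
      change sqnorm x ≤ _
      simp only [R]; nlinarith
    have hR : 0 ≤ R := by positivity
    exact ⟨abs_le.1 (abs_le_of_sq_le_sq (by nlinarith [sq_nonneg x.2]) hR),
      abs_le.1 (abs_le_of_sq_le_sq (by nlinarith [sq_nonneg x.1]) hR)⟩

lemma IsTestFun.const_smul {u : ℝ × ℝ → ℂ} (hu : IsTestFun u) (c : ℂ) : IsTestFun (c • u) :=
  ⟨contDiff_const.smul hu.1, hu.2.1.smul_left (f := fun _ => c),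
    hu.2.2.mono fun x hx => by simp [hx]⟩

lemma magEnergy_smul_modeFun (hφc : ContDiff ℝ (⊤ : ℕ∞) φ)
    (hφ : ∀ t, φ t ≠ 0 → t ∈ Set.Ioo 1 3) (hd : 0 < d) {Φ : ℝ} (hk : (Φ - k) ^ 2 = d ^ 2) (c : ℂ) :
    magEnergy Φ (c • modeFun k d φ)
      = ‖c‖ ^ 2 * (Real.pi * d * ∫ t, (4 * deriv φ t ^ 2 + φ t ^ 2)) := by
  have hu := isTestFun_modeFun (k := k) hφc hφ hd
  have hdiff : Differentiable ℝ (modeFun k d φ) := hu.1.differentiable (by simp)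
  have hdens : ∀ x, magDensity Φ (c • modeFun k d φ) x
      = ‖c‖ ^ 2 * d ^ 2 * ((fun t => 4 * deriv φ t ^ 2 + φ t ^ 2) (d * Real.log (sqnorm x))
        / sqnorm x) := by
    intro x
    rw [magDensity_const_smul Φ (hdiff x)]
    rcases eq_or_ne x 0 with rfl | hx
    · have h0 : modeFun k d φ =ᶠ[nhds 0] fun _ => 0 := modeFun_eventually_eq_zero hφ hd
      simp [magDensity, h0.fderiv_eq, sqnorm, h0.eq_of_nhds]
    · rw [magDensity_modeFun Φ k d (hφc.differentiable (by simp)) hx, hk]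
      ring
  change ∫ x, magDensity Φ (c • modeFun k d φ) x = _
  simp_rw [hdens]
  rw [integral_const_mul, integral_comp_log_sqnorm (fun t => 4 * deriv φ t ^ 2 + φ t ^ 2) hd]
  field_simp

end Mode

/-- The scale-invariant well `K / |x|²` on the annulus `1 ≤ d log |x|² ≤ 3`. -/
noncomputable def annularWell (K d : ℝ) (x : ℝ × ℝ) : ℝ :=
  K * (Set.indicator (Set.Icc 1 3) (fun _ => 1) (d * Real.log (sqnorm x)) / sqnorm x)

lemma measurable_annularWell (K d : ℝ) : Measurable (annularWell K d) := by
  have hs := continuous_sqnorm.measurable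
  have h : Measurable (Set.indicator (Set.Icc (1 : ℝ) 3) fun _ => (1 : ℝ)) :=
    measurable_const.indicator measurableSet_Icc
  exact ((h.comp ((Real.measurable_log.comp hs).const_mul d)).div hs).const_mul K

lemma annularWell_rpow {α K : ℝ} (hα : 0 < α) (hK : 0 < K) (d : ℝ) (x : ℝ × ℝ) :
    (max (annularWell K d x) 0) ^ (1 + α / 2) * Real.sqrt (sqnorm x) ^ α
      = K ^ (1 + α / 2) *
        (Set.indicator (Set.Icc 1 3) (fun _ => 1) (d * Real.log (sqnorm x)) / sqnorm x) := by
  have hp : 1 + α / 2 ≠ 0 := by positivity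
  rcases eq_or_ne x 0 with rfl | hx
  · simp [annularWell, sqnorm, Real.zero_rpow hα.ne']
  have hs := sqnorm_pos hx
  by_cases h : d * Real.log (sqnorm x) ∈ Set.Icc (1 : ℝ) 3
  · simp only [annularWell, Set.indicator_of_mem h]
    rw [max_eq_left (by positivity), Real.mul_rpow hK.le (by positivity),
      Real.div_rpow zero_le_one hs.le, Real.one_rpow, Real.sqrt_eq_rpow, ← Real.rpow_mul hs.le,
      Real.rpow_add hs, Real.rpow_one, show 1 / 2 * α = α / 2 by ring]
    have := Real.rpow_pos_of_pos hs (α / 2)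
    field_simp
  · simp [annularWell, Set.indicator_of_notMem h, Real.zero_rpow hp]

lemma integral_annularWell_rpow {α K d : ℝ} (hα : 0 < α) (hK : 0 < K) (hd : 0 < d) :
    ∫ x, (max (annularWell K d x) 0) ^ (1 + α / 2) * Real.sqrt (sqnorm x) ^ α
      = K ^ (1 + α / 2) * (2 * Real.pi / d) := by
  simp_rw [annularWell_rpow hα hK]
  rw [integral_const_mul, integral_comp_log_sqnorm _ hd, integral_indicator measurableSet_Icc]
  simp [show (3 : ℝ) - 1 = 2 by norm_num]
  ring_nf
  simp

lemma integral_annularWell_mul_modeFun {φ : ℝ → ℝ} (hφ : ∀ t, φ t ≠ 0 → t ∈ Set.Ioo 1 3)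
    (K : ℝ) {d : ℝ} (hd : 0 < d) (k : ℤ) (c : ℂ) :
    ∫ x, annularWell K d x * ‖(c • modeFun k d φ) x‖ ^ 2
      = ‖c‖ ^ 2 * (K * (Real.pi / d * ∫ t, φ t ^ 2)) := by
  have h : ∀ x, annularWell K d x * ‖(c • modeFun k d φ) x‖ ^ 2
      = ‖c‖ ^ 2 * K * ((fun t => φ t ^ 2) (d * Real.log (sqnorm x)) / sqnorm x) := by
    intro x
    rcases eq_or_ne x 0 with rfl | hx
    · simp [annularWell, sqnorm]
    rw [Pi.smul_apply, norm_smul, mul_pow, norm_sq_modeFun k d φ hx, annularWell]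
    by_cases hmem : d * Real.log (sqnorm x) ∈ Set.Icc (1 : ℝ) 3
    · rw [Set.indicator_of_mem hmem]; ring
    · have : φ (d * Real.log (sqnorm x)) = 0 := by
        by_contra hne
        exact hmem (Set.Ioo_subset_Icc_self (hφ _ hne))
      simp [this]
  simp_rw [h]
  rw [integral_const_mul, integral_comp_log_sqnorm (fun t => φ t ^ 2) hd]
  ring

/-- A smooth profile supported in `(1, 3)`. -/
lemma exists_profile : ∃ φ : ℝ → ℝ, ContDiff ℝ (⊤ : ℕ∞) φ ∧
    (∀ t, φ t ≠ 0 → t ∈ Set.Ioo (1 : ℝ) 3) ∧ 0 < ∫ t, φ t ^ 2 := by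
  let f : ContDiffBump (2 : ℝ) := ⟨1 / 2, 1, by norm_num, by norm_num⟩
  refine ⟨f, f.contDiff, fun t ht => ?_, ?_⟩
  · have : t ∈ Function.support f := ht
    rw [f.support_eq, Real.ball_eq_Ioo] at this
    norm_num at this
    exact this
  · have hcs : HasCompactSupport fun t => f t ^ 2 :=
      f.hasCompactSupport.comp_left (g := fun y : ℝ => y ^ 2) (by simp)
    exact (f.continuous.pow 2).integral_pos_of_hasCompactSupport_nonneg_nonzero hcs
      (fun t => sq_nonneg _) (x := 2)
      (by simp [f.one_of_mem_closedBall (Metric.mem_closedBall_self f.rIn_pos.le)])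

theorem weighted_CLR_constant_lower_bound (α : ℝ) (hα : 0 < α) :
    ∃ c : ℝ, 0 < c ∧
      ∀ Φ : ℝ, (∀ k : ℤ, Φ ≠ k) →
      ∀ C : ℝ, 0 ≤ C →
        (∀ V : ℝ × ℝ → ℝ, Measurable V →
          Integrable
            (fun x : ℝ × ℝ => (max (V x) 0) ^ (1 + α / 2) * Real.sqrt (sqnorm x) ^ α) →
          ∀ M : Submodule ℂ (ℝ × ℝ → ℂ), FiniteDimensional ℂ M → IsVNegative Φ V M →
            (Module.finrank ℂ M : ℝ) ≤
              C * ∫ x : ℝ × ℝ, (max (V x) 0) ^ (1 + α / 2) * Real.sqrt (sqnorm x) ^ α) →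
        c * distToInt Φ ^ (-(1 + α)) ≤ C := by
  obtain ⟨φ, hφc, hφ, hφpos⟩ := exists_profile
  set P := ∫ t, φ t ^ 2
  set Q := ∫ t, (4 * deriv φ t ^ 2 + φ t ^ 2)
  have hQ : 0 ≤ Q := integral_nonneg fun t => by positivity
  set K := Q / P + 1
  have hK : 0 < K := by positivity
  have hKp := Real.rpow_pos_of_pos hK (1 + α / 2)
  refine ⟨(2 * Real.pi * K ^ (1 + α / 2))⁻¹, by positivity, fun Φ hΦ C hC hCLR => ?_⟩
  set d := distToInt Φ
  have hd : 0 < d := abs_pos.2 (sub_ne_zero.2 (hΦ _))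
  have hk : (Φ - round Φ) ^ 2 = d ^ 2 := (sq_abs _).symm
  have hKd : 0 < K * d ^ 2 := by positivity
  set u := modeFun (round Φ) d φ
  have hint := integral_annularWell_rpow hα hKd hd
  have hneg : IsVNegative Φ (annularWell (K * d ^ 2) d) (Submodule.span ℂ {u}) := by
    refine ⟨fun v hv => ?_, fun v hv hv0 => ?_⟩ <;>
      obtain ⟨c, rfl⟩ := Submodule.mem_span_singleton.1 hv
    · exact (isTestFun_modeFun hφc hφ hd).const_smul c
    · have hc : 0 < ‖c‖ := norm_pos_iff.2 (left_ne_zero_of_smul hv0)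
      rw [magEnergy_smul_modeFun hφc hφ hd hk, integral_annularWell_mul_modeFun hφ _ hd]
      have hKP : K * P = Q + P := by simp only [K]; field_simp
      have : K * d ^ 2 * (Real.pi / d * P) = Real.pi * d * (Q + P) := by
        rw [← hKP]; field_simp
      rw [this]
      gcongr
      linarith
  have hu : u ≠ 0 := by
    intro h0
    have h := integral_annularWell_mul_modeFun hφ 1 hd (round Φ) 1
    have hz : modeFun (round Φ) d φ = 0 := h0
    rw [hz] at h
    have : 0 < 1 * (Real.pi / d * P) := by positivity
    exact this.ne (by simpa using h)
  have hmain := hCLR _ (measurable_annularWell (K * d ^ 2) d)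
    (Integrable.of_integral_ne_zero (by rw [hint]; positivity)) _ inferInstance hneg
  rw [finrank_span_singleton hu, hint, Real.mul_rpow hK.le (by positivity)] at hmain
  have hpow : (d ^ 2) ^ (1 + α / 2) = d ^ (1 + α) * d := by
    rw [← Real.rpow_natCast, ← Real.rpow_mul hd.le, ← Real.rpow_add_one hd.ne']
    congr 1; push_cast; ring
  rw [hpow] at hmain
  have hdp := Real.rpow_pos_of_pos hd (1 + α)
  rw [Real.rpow_neg hd.le, ← mul_inv, inv_le_iff_one_le_mul₀ (by positivity)]
  calc (1 : ℝ) = ((1 : ℕ) : ℝ) := by norm_num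
    _ ≤ _ := hmain
    _ = _ := by field_simp
end
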